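/- arXiv:1012.1301 — 3 statements merged into one kernel-verified Lean document; each statement's English description precedes it below -/
import Mathlib

section
/- Let σ ⊂ ℝ^d be a strongly convex polyhedral cone with ns(σ) > 0. Then the set of faces τ of σ satisfying ns(τ) = ns(σ), partially ordered by inclusion, has a least element; in other words, there is a unique face τ of σ with ns(τ) = ns(σ) that is minimal with respect to inclusion among such faces, and it is contained in every face of σ whose non-simplicial index equals ns(σ). -/
open scoped BigOperators

noncomputable section

/-- The conical hull of a set `S` in `ℝ^d`: all finite nonnegative combinations of
elements of `S`.  For a finite set `S` this is the polyhedral cone `Cone(S)`. -/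
def coneHull {d : ℕ} (S : Set (Fin d → ℝ)) : Set (Fin d → ℝ) :=
  {x | ∃ (T : Finset (Fin d → ℝ)) (c : (Fin d → ℝ) → ℝ),
    ↑T ⊆ S ∧ (∀ v ∈ T, 0 ≤ c v) ∧ x = ∑ v ∈ T, c v • v}

/-- A polyhedral cone is the conical hull of a finite set. -/
def IsPolyhedralCone {d : ℕ} (σ : Set (Fin d → ℝ)) : Prop :=
  ∃ S : Finset (Fin d → ℝ), σ = coneHull ↑S

/-- A cone is strongly convex if it contains no line through the origin. -/
def StronglyConvex {d : ℕ} (σ : Set (Fin d → ℝ)) : Prop :=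
  ∀ x ∈ σ, -x ∈ σ → x = 0

/-- `τ` is a face of `σ`: `τ = σ ∩ ker u` for a linear functional `u` nonnegative on `σ`. -/
def IsFaceOf {d : ℕ} (σ τ : Set (Fin d → ℝ)) : Prop :=
  ∃ u : (Fin d → ℝ) →ₗ[ℝ] ℝ, (∀ x ∈ σ, 0 ≤ u x) ∧ τ = {x ∈ σ | u x = 0}

/-- The dimension of the linear span of a subset of `ℝ^d`. -/
def dimSet {d : ℕ} (s : Set (Fin d → ℝ)) : ℕ :=
  Module.finrank ℝ (Submodule.span ℝ s)

/-- The set of rays (one-dimensional faces) of a cone `σ`. -/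
def raysOf {d : ℕ} (σ : Set (Fin d → ℝ)) : Set (Set (Fin d → ℝ)) :=
  {ρ | IsFaceOf σ ρ ∧ dimSet ρ = 1}

/-- The non-simplicial index `ns(σ) = |σ(1)| − dim σ`. -/
def nsCone {d : ℕ} (σ : Set (Fin d → ℝ)) : ℤ :=
  ((raysOf σ).ncard : ℤ) - (dimSet σ : ℤ)

open Classical in
lemma mem_hull_iff {d : ℕ} (G : Finset (Fin d → ℝ)) (x : Fin d → ℝ) :
    x ∈ coneHull (G : Set (Fin d → ℝ)) ↔
      ∃ c : (Fin d → ℝ) → ℝ, (∀ v ∈ G, 0 ≤ c v) ∧ x = ∑ v ∈ G, c v • v := by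
  constructor
  · rintro ⟨T, c, hT, hc, rfl⟩
    refine ⟨fun v => if v ∈ T then c v else 0, ?_, ?_⟩
    · intro v _
      by_cases h : v ∈ T
      · simp [h, hc v h]
      · simp [h]
    · have hT' : T ⊆ G := by exact_mod_cast hT
      rw [← Finset.sum_subset hT']
      · apply Finset.sum_congr rfl
        intro v hv
        simp [hv]
      · intro v _ hv
        simp [hv]
  · rintro ⟨c, hc, rfl⟩
    exact ⟨G, c, subset_rfl, hc, rfl⟩

lemma hull_mono {d : ℕ} {S T : Set (Fin d → ℝ)} (h : S ⊆ T) : coneHull S ⊆ coneHull T := by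
  rintro x ⟨A, c, hA, hc, rfl⟩
  exact ⟨A, c, hA.trans h, hc, rfl⟩

lemma smul_mem_hull {d : ℕ} {S : Set (Fin d → ℝ)} {g : Fin d → ℝ} (hg : g ∈ S) {t : ℝ}
    (ht : 0 ≤ t) : t • g ∈ coneHull S :=
  ⟨{g}, fun _ => t, by simpa using hg, by simpa using ht, by simp⟩

lemma mem_hull_of_mem {d : ℕ} {S : Set (Fin d → ℝ)} {g : Fin d → ℝ} (hg : g ∈ S) :
    g ∈ coneHull S := by
  simpa using smul_mem_hull hg (zero_le_one' ℝ)

lemma zero_mem_hull {d : ℕ} (S : Set (Fin d → ℝ)) : (0 : Fin d → ℝ) ∈ coneHull S :=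
  ⟨∅, fun _ => 0, by simp, by simp, by simp⟩

lemma span_hull {d : ℕ} (S : Set (Fin d → ℝ)) :
    Submodule.span ℝ (coneHull S) = Submodule.span ℝ S := by
  apply le_antisymm
  · rw [Submodule.span_le]
    rintro x ⟨A, c, hA, hc, rfl⟩
    exact Submodule.sum_mem _ fun v hv => Submodule.smul_mem _ _ (Submodule.subset_span (hA hv))
  · exact Submodule.span_mono fun x hx => mem_hull_of_mem hx

def Irred {d : ℕ} (G : Finset (Fin d → ℝ)) : Prop :=
  ∀ g ∈ G, g ∉ coneHull ((G : Set (Fin d → ℝ)) \ {g})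

lemma Irred.mono {d : ℕ} {A G : Finset (Fin d → ℝ)} (hG : Irred G) (h : A ⊆ G) : Irred A :=
  fun g hg hh => hG g (h hg) (hull_mono (Set.sdiff_subset_sdiff_left (by exact_mod_cast h)) hh)

lemma Irred.ne_zero {d : ℕ} {G : Finset (Fin d → ℝ)} (hG : Irred G) {g} (hg : g ∈ G) : g ≠ 0 := by
  rintro rfl
  exact hG _ hg (zero_mem_hull _)

open Classical in
lemma hull_erase {d : ℕ} {G : Finset (Fin d → ℝ)} {g} (hg : g ∈ G)
    (h : g ∈ coneHull ((G : Set (Fin d → ℝ)) \ {g})) :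
    coneHull (G : Set (Fin d → ℝ)) = coneHull ((G.erase g : Finset _) : Set (Fin d → ℝ)) := by
  apply Set.Subset.antisymm
  · intro x hx
    rw [← Finset.coe_erase, mem_hull_iff] at h
    rw [mem_hull_iff] at hx ⊢
    obtain ⟨e, he, hge⟩ := h
    obtain ⟨c, hc, rfl⟩ := hx
    refine ⟨fun v => c g * e v + c v, fun v hv => ?_, ?_⟩
    · have := hc v (Finset.mem_of_mem_erase hv)
      have := he v hv
      have := hc g hg
      positivity
    · rw [← Finset.add_sum_erase _ _ hg]
      simp only [add_smul, mul_smul, Finset.sum_add_distrib, ← Finset.smul_sum]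
      rw [← hge]
  · exact hull_mono (by simp)

lemma exists_irred {d : ℕ} (S : Finset (Fin d → ℝ)) :
    ∃ G : Finset (Fin d → ℝ), Irred G ∧
      coneHull (S : Set (Fin d → ℝ)) = coneHull (G : Set (Fin d → ℝ)) := by
  classical
  induction hn : S.card using Nat.strong_induction_on generalizing S with
  | _ n ih =>
    by_cases h : Irred S
    · exact ⟨S, h, rfl⟩
    · unfold Irred at h
      push Not at h
      obtain ⟨g, hg, hh⟩ := h
      obtain ⟨G, hG, e⟩ := ih _ (hn ▸ Finset.card_erase_lt_of_mem hg) (S.erase g) rfl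
      exact ⟨G, hG, (hull_erase hg hh).trans e⟩

lemma exists_functional {d : ℕ} {G : Finset (Fin d → ℝ)} (hG : Irred G)
    (hs : StronglyConvex (coneHull (G : Set (Fin d → ℝ)))) {g} (hg : g ∈ G) :
    ∃ u : (Fin d → ℝ) →ₗ[ℝ] ℝ, u g = 0 ∧ ∀ v ∈ G, v ≠ g → 0 < u v := by
  classical
  set E := G.erase g with hE
  have hdis : Disjoint (convexHull ℝ (E : Set (Fin d → ℝ)))
      ((Submodule.span ℝ {g} : Submodule ℝ (Fin d → ℝ)) : Set (Fin d → ℝ)) := by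
    rw [Set.disjoint_left]
    intro x hx hx'
    rw [Finset.convexHull_eq] at hx
    obtain ⟨w, hw, hw1, hwx⟩ := hx
    rw [Finset.centerMass_eq_of_sum_1 _ _ hw1] at hwx
    simp only [id] at hwx
    obtain ⟨t, rfl⟩ := Submodule.mem_span_singleton.1 hx'
    rcases lt_or_ge 0 t with ht | ht
    · apply hG g hg
      rw [← Finset.coe_erase, mem_hull_iff]
      refine ⟨fun v => t⁻¹ * w v, fun v hv => mul_nonneg (by positivity) (hw v hv), ?_⟩
      simp only [mul_smul, ← Finset.smul_sum]
      rw [← hE, hwx, smul_smul, inv_mul_cancel₀ ht.ne', one_smul]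
    · obtain ⟨i, hi, hwi⟩ : ∃ i ∈ E, 0 < w i := by
        by_contra! hcon
        have := Finset.sum_nonpos hcon
        linarith
      have hiG : i ∈ G := Finset.mem_of_mem_erase hi
      have h0 : w i • i = 0 := by
        apply hs
        · exact smul_mem_hull (by exact_mod_cast hiG) hwi.le
        · rw [mem_hull_iff]
          refine ⟨fun v => if v = g then -t else if v = i then 0 else w v, ?_, ?_⟩
          · intro v hv
            dsimp only
            split_ifs with h1 h2
            · linarith
            · exact le_rfl
            · exact hw v (Finset.mem_erase.2 ⟨h1, hv⟩)
          · rw [← Finset.add_sum_erase _ _ hg, ← hE, ← Finset.add_sum_erase _ _ hi]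
            rw [← Finset.add_sum_erase _ _ hi] at hwx
            have hig : i ≠ g := Finset.ne_of_mem_erase hi
            have : ∑ x ∈ E.erase i, (if x = g then -t else if x = i then 0 else w x) • x
                = ∑ x ∈ E.erase i, w x • x := by
              apply Finset.sum_congr rfl
              intro v hv
              rw [if_neg, if_neg (Finset.ne_of_mem_erase hv)]
              exact Finset.ne_of_mem_erase (Finset.mem_of_mem_erase hv)
            rw [this]
            simp only [if_true, hig, if_false, zero_smul, zero_add, neg_smul]
            rw [← hwx]
            abel
      rcases smul_eq_zero.1 h0 with h | h
      · exact hwi.ne' h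
      · exact hG.ne_zero hiG h
  obtain ⟨f, a, b, h1, h2, h3⟩ := geometric_hahn_banach_compact_closed (convex_convexHull ℝ _)
    (E.finite_toSet.isCompact_convexHull ℝ) (Submodule.convex _)
    (Submodule.closed_of_finiteDimensional _) hdis
  have hb : b < 0 := by simpa using h3 0 (Submodule.zero_mem _)
  have hfg : f g = 0 := by
    by_contra hne
    have := h3 ((b / f g) • g) (Submodule.smul_mem _ _ (Submodule.mem_span_singleton_self g))
    rw [map_smul, smul_eq_mul, div_mul_cancel₀ _ hne] at this
    exact lt_irrefl _ this
  refine ⟨-f.toLinearMap, by simp [hfg], fun v hv hvg => ?_⟩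
  have := h1 v (subset_convexHull ℝ _ (by simp [hE, hv, hvg]))
  simp only [LinearMap.neg_apply, ContinuousLinearMap.coe_coe]
  linarith

open Classical in
lemma face_eq {d : ℕ} {G : Finset (Fin d → ℝ)} {u : (Fin d → ℝ) →ₗ[ℝ] ℝ}
    (hu : ∀ v ∈ G, 0 ≤ u v) :
    {x ∈ coneHull (G : Set (Fin d → ℝ)) | u x = 0} =
      coneHull ((G.filter fun v => u v = 0 : Finset _) : Set (Fin d → ℝ)) := by
  ext x
  simp only [Set.mem_ofPred_eq, mem_hull_iff]
  constructor
  · rintro ⟨⟨c, hc, rfl⟩, h⟩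
    refine ⟨c, fun v hv => hc v (Finset.mem_filter.1 hv).1, ?_⟩
    rw [map_sum] at h
    simp only [map_smul, smul_eq_mul] at h
    rw [Finset.sum_eq_zero_iff_of_nonneg (fun v hv => mul_nonneg (hc v hv) (hu v hv))] at h
    symm
    apply Finset.sum_subset (Finset.filter_subset _ _)
    intro v hv hv'
    rcases mul_eq_zero.1 (h v hv) with h' | h'
    · simp [h']
    · exact absurd (Finset.mem_filter.2 ⟨hv, h'⟩) hv'
  · rintro ⟨c, hc, rfl⟩
    refine ⟨(mem_hull_iff _ _).1 (hull_mono (S := ((G.filter fun v => u v = 0 : Finset _) : Set _))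
      (Finset.coe_subset.2 (Finset.filter_subset _ _)) ((mem_hull_iff _ _).2 ⟨c, hc, rfl⟩)), ?_⟩
    rw [map_sum]
    apply Finset.sum_eq_zero
    intro v hv
    simp [(Finset.mem_filter.1 hv).2]

lemma hull_nonneg {d : ℕ} {G : Finset (Fin d → ℝ)} {u : (Fin d → ℝ) →ₗ[ℝ] ℝ}
    (hu : ∀ v ∈ G, 0 ≤ u v) : ∀ x ∈ coneHull (G : Set (Fin d → ℝ)), 0 ≤ u x := by
  intro x hx
  obtain ⟨c, hc, rfl⟩ := (mem_hull_iff _ _).1 hx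
  rw [map_sum]
  apply Finset.sum_nonneg
  intro v hv
  simpa using mul_nonneg (hc v hv) (hu v hv)

lemma rays_ncard {d : ℕ} {G : Finset (Fin d → ℝ)} (hG : Irred G)
    (hs : StronglyConvex (coneHull (G : Set (Fin d → ℝ)))) :
    (raysOf (coneHull (G : Set (Fin d → ℝ)))).ncard = G.card := by
  classical
  have himg : raysOf (coneHull (G : Set (Fin d → ℝ))) =
      (fun g => coneHull {g}) '' (G : Set (Fin d → ℝ)) := by
    ext ρ
    constructor
    · rintro ⟨⟨u, hu, rfl⟩, hd⟩
      have hu' : ∀ v ∈ G, 0 ≤ u v := fun v hv => hu v (mem_hull_of_mem (by exact_mod_cast hv))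
      rw [face_eq hu'] at hd ⊢
      set A := G.filter fun v => u v = 0 with hA
      have hAG : A ⊆ G := Finset.filter_subset _ _
      unfold dimSet at hd
      rw [span_hull] at hd
      have hne : A.Nonempty := by
        rw [Finset.nonempty_iff_ne_empty]
        intro h
        rw [h, Finset.coe_empty, Submodule.span_empty, finrank_bot] at hd
        exact zero_ne_one hd
      obtain ⟨g, hg⟩ := hne
      refine ⟨g, by exact_mod_cast hAG hg, ?_⟩
      have hAg : A = {g} := by
        rw [Finset.eq_singleton_iff_unique_mem]
        refine ⟨hg, fun v hv => ?_⟩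
        by_contra hvg
        have hg0 := hG.ne_zero (hAG hg)
        have hv0 := hG.ne_zero (hAG hv)
        obtain ⟨t, ht⟩ := (finrank_eq_one_iff_of_nonzero'
          (⟨g, Submodule.subset_span (by exact_mod_cast hg)⟩ :
            Submodule.span ℝ (A : Set (Fin d → ℝ)))
          (by simpa [Subtype.ext_iff] using hg0)).1 hd
          ⟨v, Submodule.subset_span (by exact_mod_cast hv)⟩
        have ht' : t • g = v := congrArg Subtype.val ht
        rcases le_or_gt 0 t with h | h
        · apply hG v (hAG hv)
          have hmem : g ∈ (G : Set (Fin d → ℝ)) \ {v} :=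
            ⟨by exact_mod_cast hAG hg, fun hh => hvg hh.symm⟩
          have := smul_mem_hull hmem h
          rwa [ht'] at this
        · apply hv0
          apply hs
          · exact mem_hull_of_mem (by exact_mod_cast hAG hv)
          · rw [← ht', ← neg_smul]
            exact smul_mem_hull (by exact_mod_cast hAG hg) (by linarith)
      rw [hAg]
      simp
    · rintro ⟨g, hg, rfl⟩
      have hg : g ∈ G := by exact_mod_cast hg
      obtain ⟨u, hug, hu⟩ := exists_functional hG hs hg
      have hu' : ∀ v ∈ G, 0 ≤ u v := fun v hv => by
        by_cases h : v = g
        · rw [h, hug]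
        · exact (hu v hv h).le
      refine ⟨⟨u, hull_nonneg hu', ?_⟩, ?_⟩
      · rw [face_eq hu']
        refine congrArg coneHull ?_
        ext v
        rw [Set.mem_singleton_iff, Finset.mem_coe, Finset.mem_filter]
        constructor
        · rintro rfl
          exact ⟨hg, hug⟩
        · rintro ⟨h1, h2⟩
          by_contra h
          exact (hu v h1 h).ne' h2
      · unfold dimSet
        dsimp only
        rw [span_hull]
        exact finrank_span_singleton (hG.ne_zero hg)
  rw [himg, Set.InjOn.ncard_image, Set.ncard_coe_finset]
  intro g hg g' hg' h
  by_contra hne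
  apply hG g hg
  have : g ∈ coneHull {g} := mem_hull_of_mem rfl
  dsimp only at h
  rw [h] at this
  refine hull_mono ?_ this
  rintro _ rfl
  exact ⟨hg', fun hh => hne hh.symm⟩

/-- rank of a finset -/
def rk {d : ℕ} (A : Finset (Fin d → ℝ)) : ℕ :=
  Module.finrank ℝ (Submodule.span ℝ (A : Set (Fin d → ℝ)))

lemma ns_hull {d : ℕ} {G : Finset (Fin d → ℝ)} (hG : Irred G)
    (hs : StronglyConvex (coneHull (G : Set (Fin d → ℝ)))) :
    nsCone (coneHull (G : Set (Fin d → ℝ))) = (G.card : ℤ) - rk G := by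
  unfold nsCone dimSet rk
  rw [rays_ncard hG hs, span_hull]

open Classical in
lemma rk_submod {d : ℕ} (A B : Finset (Fin d → ℝ)) :
    rk (A ∪ B) + rk (A ∩ B) ≤ rk A + rk B := by
  unfold rk
  rw [← Submodule.finrank_sup_add_finrank_inf_eq (Submodule.span ℝ (A : Set (Fin d → ℝ))),
    Finset.coe_union, Submodule.span_union]
  apply Nat.add_le_add_left
  apply Submodule.finrank_mono
  exact le_inf (Submodule.span_mono (Finset.coe_subset.2 (Finset.inter_subset_left (s₁ := A) (s₂ := B))))
    (Submodule.span_mono (Finset.coe_subset.2 (Finset.inter_subset_right (s₁ := A) (s₂ := B))))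

open Classical in
lemma rk_mono_null {d : ℕ} {A G : Finset (Fin d → ℝ)} (h : A ⊆ G) :
    (A.card : ℤ) - rk A ≤ (G.card : ℤ) - rk G := by
  have h1 := rk_submod A (G \ A)
  rw [Finset.union_sdiff_of_subset h] at h1
  have h2 : rk (G \ A) ≤ (G \ A).card := finrank_span_finset_le_card _
  have h3 := Finset.card_sdiff_add_card_eq_card h
  omega

theorem stmt1 {d : ℕ} (σ : Set (Fin d → ℝ)) (hσ : IsPolyhedralCone σ)
    (hsc : StronglyConvex σ) (hns : 0 < nsCone σ) :
    ∃ τ, IsFaceOf σ τ ∧ nsCone τ = nsCone σ ∧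
      ∀ τ', IsFaceOf σ τ' → nsCone τ' = nsCone σ → τ ⊆ τ' := by
  classical
  obtain ⟨S, rfl⟩ := hσ
  obtain ⟨G, hG, hSG⟩ := exists_irred S
  rw [hSG] at hsc ⊢
  clear hns hSG
  -- faces
  have key : ∀ τ, IsFaceOf (coneHull (G : Set (Fin d → ℝ))) τ → ∃ A ⊆ G,
      τ = coneHull (A : Set (Fin d → ℝ)) ∧ (∀ v ∈ G, v ∈ τ → v ∈ A) ∧
      nsCone τ = (A.card : ℤ) - rk A := by
    rintro τ ⟨u, hu, rfl⟩
    have hu' : ∀ v ∈ G, 0 ≤ u v := fun v hv => hu v (mem_hull_of_mem (by exact_mod_cast hv))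
    refine ⟨G.filter fun v => u v = 0, Finset.filter_subset _ _, face_eq hu', ?_, ?_⟩
    · intro v hv hv'
      exact Finset.mem_filter.2 ⟨hv, hv'.2⟩
    · rw [face_eq hu']
      have hsub : coneHull ((G.filter fun v => u v = 0 : Finset _) : Set (Fin d → ℝ)) ⊆
        coneHull (G : Set (Fin d → ℝ)) :=
        hull_mono (Finset.coe_subset.2 (Finset.filter_subset _ _))
      exact ns_hull (hG.mono (Finset.filter_subset _ _))
        fun x hx hx' => hsc x (hsub hx) (hsub hx')
  have hinter : ∀ τ τ', IsFaceOf (coneHull (G : Set (Fin d → ℝ))) τ →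
      IsFaceOf (coneHull (G : Set (Fin d → ℝ))) τ' →
      IsFaceOf (coneHull (G : Set (Fin d → ℝ))) (τ ∩ τ') := by
    rintro _ _ ⟨u, hu, rfl⟩ ⟨w, hw, rfl⟩
    refine ⟨u + w, fun x hx => add_nonneg (hu x hx) (hw x hx), ?_⟩
    ext x
    simp only [Set.mem_inter_iff, Set.mem_ofPred_eq, LinearMap.add_apply]
    constructor
    · rintro ⟨⟨h, h1⟩, _, h2⟩
      exact ⟨h, by linarith⟩
    · rintro ⟨h, h1⟩
      have := hu x h
      have := hw x h
      exact ⟨⟨h, by linarith⟩, h, by linarith⟩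
  have hnsG := ns_hull hG hsc
  let P : ℕ → Prop := fun n => ∃ τ, IsFaceOf (coneHull (G : Set (Fin d → ℝ))) τ ∧
    nsCone τ = nsCone (coneHull (G : Set (Fin d → ℝ))) ∧ (G.filter fun v => v ∈ τ).card = n
  have hP : ∃ n, P n := ⟨_, coneHull (G : Set (Fin d → ℝ)), ⟨0, by simp, by simp⟩, rfl, rfl⟩
  obtain ⟨τ, hτ, hτns, hτc⟩ := Nat.find_spec hP
  refine ⟨τ, hτ, hτns, fun τ' hτ' hns' => ?_⟩
  have hI := hinter τ τ' hτ hτ'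
  obtain ⟨A, hAG, hA, hA2, hAn⟩ := key τ hτ
  obtain ⟨B, hBG, hB, hB2, hBn⟩ := key τ' hτ'
  obtain ⟨C, hCG, hC, hC2, hCn⟩ := key _ hI
  have memA : ∀ v ∈ A, v ∈ τ := fun v hv => hA ▸ mem_hull_of_mem (by exact_mod_cast hv)
  have memB : ∀ v ∈ B, v ∈ τ' := fun v hv => hB ▸ mem_hull_of_mem (by exact_mod_cast hv)
  have memC : ∀ v ∈ C, v ∈ τ ∩ τ' := fun v hv => hC ▸ mem_hull_of_mem (by exact_mod_cast hv)
  have hCAB : C = A ∩ B := by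
    ext v
    rw [Finset.mem_inter]
    constructor
    · intro h
      exact ⟨hA2 v (hCG h) (memC v h).1, hB2 v (hCG h) (memC v h).2⟩
    · rintro ⟨h1, h2⟩
      exact hC2 v (hAG h1) ⟨memA v h1, memB v h2⟩
  have hInsEq : nsCone (τ ∩ τ') = nsCone (coneHull (G : Set (Fin d → ℝ))) := by
    have h1 := rk_submod A B
    have h2 := rk_mono_null (Finset.union_subset hAG hBG)
    have h3 := rk_mono_null hCG
    have h4 := Finset.card_union_add_card_inter A B
    rw [hCAB] at hCn h3
    omega
  have hmin := Nat.find_min' hP ⟨τ ∩ τ', hI, hInsEq, rfl⟩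
  rw [← hτc] at hmin
  have hsub : (G.filter fun v => v ∈ τ ∩ τ') ⊆ G.filter fun v => v ∈ τ := by
    intro v hv
    simp only [Finset.mem_filter] at hv ⊢
    exact ⟨hv.1, hv.2.1⟩
  have heq := Finset.eq_of_subset_of_card_le hsub (by convert hmin)
  rw [hA, hB]
  apply hull_mono
  intro v hv
  have hv : v ∈ A := by exact_mod_cast hv
  have h1 : v ∈ G.filter fun v => v ∈ τ := Finset.mem_filter.2 ⟨hAG hv, memA v hv⟩
  rw [← heq] at h1
  have := hB2 v (hAG hv) (Finset.mem_filter.1 h1).2.2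
  exact_mod_cast this
end
end

section
/- Let Σ be a fan in ℝ^d with ns(Σ) > 0 and let σ, σ' be two distinct minimal non-simplicial cones of Σ. Then no cone of Σ contains both σ and σ'. -/
open scoped BigOperators

noncomputable section

/-- A fan in `ℝ^d`: a finite collection of strongly convex polyhedral cones, closed
under taking faces, such that the intersection of any two cones is a face of each. -/
def IsFan {d : ℕ} (F : Set (Set (Fin d → ℝ))) : Prop :=
  F.Finite ∧ (∀ σ ∈ F, IsPolyhedralCone σ ∧ StronglyConvex σ) ∧
    (∀ σ ∈ F, ∀ τ, IsFaceOf σ τ → τ ∈ F) ∧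
    (∀ σ ∈ F, ∀ σ' ∈ F, IsFaceOf σ (σ ∩ σ') ∧ IsFaceOf σ' (σ ∩ σ'))

/-- The non-simplicial index of a fan: `ns(Σ) = max_{σ ∈ Σ} ns(σ)`. -/
def nsFan {d : ℕ} (F : Set (Set (Fin d → ℝ))) : ℤ :=
  sSup (nsCone '' F)

/-- A minimal non-simplicial cone of a fan `F`: a cone of `F` whose non-simplicial index
equals `ns(F)` and which is minimal with respect to inclusion among such cones. -/
def IsMinNonSimpCone {d : ℕ} (F : Set (Set (Fin d → ℝ))) (σ : Set (Fin d → ℝ)) : Prop :=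
  σ ∈ F ∧ nsCone σ = nsFan F ∧
    ∀ τ ∈ F, nsCone τ = nsFan F → τ ⊆ σ → τ = σ

/-- The star subdivision of the fan `F` along the cone `σ` at the point `v0` (a point of
the relative interior of `σ`): it consists of the cones of `F` not containing `σ`,
together with the cones `Cone(τ ∪ {v0})` for `μ` a cone of `F` containing `σ` and
`τ` a face of `μ` not containing `σ`. -/
def starSubdiv {d : ℕ} (F : Set (Set (Fin d → ℝ))) (σ : Set (Fin d → ℝ))
    (v0 : Fin d → ℝ) : Set (Set (Fin d → ℝ)) :=
  {μ ∈ F | ¬ σ ⊆ μ} ∪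
    {c | ∃ μ ∈ F, σ ⊆ μ ∧ ∃ τ, IsFaceOf μ τ ∧ ¬ σ ⊆ τ ∧ c = coneHull (τ ∪ {v0})}

lemma coneHull_eq_hull {d : ℕ} (S : Set (Fin d → ℝ)) :
    coneHull S = (PointedCone.hull ℝ S : Set (Fin d → ℝ)) := by
  ext x
  constructor
  · rintro ⟨T, c, hT, hc, rfl⟩
    refine Submodule.sum_mem _ fun v hv => ?_
    exact Submodule.smul_mem (PointedCone.hull ℝ S) ⟨c v, hc v hv⟩ (Submodule.subset_span (hT hv))
  · intro hx
    obtain ⟨f, T, hT, -, rfl⟩ := Submodule.mem_span_iff_exists_finset_subset.1 hx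
    exact ⟨T, fun v => (f v : ℝ), hT, fun v _ => (f v).2, rfl⟩

lemma hull_smul_mem {d : ℕ} (C : PointedCone ℝ (Fin d → ℝ)) {a : ℝ} (ha : 0 ≤ a)
    {x : Fin d → ℝ} (hx : x ∈ C) : a • x ∈ C :=
  Submodule.smul_mem C ⟨a, ha⟩ hx

lemma exists_min_gen {d : ℕ} (S : Finset (Fin d → ℝ)) :
    ∃ T : Finset (Fin d → ℝ), PointedCone.hull ℝ (T : Set (Fin d → ℝ)) = PointedCone.hull ℝ S ∧
      ∀ s ∈ T, s ∉ PointedCone.hull ℝ ((T.erase s : Finset _) : Set (Fin d → ℝ)) := by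
  induction hn : S.card using Nat.strong_induction_on generalizing S with
  | _ n ih =>
    by_cases h : ∃ s ∈ S, s ∈ PointedCone.hull ℝ ((S.erase s : Finset _) : Set (Fin d → ℝ))
    · obtain ⟨s, hs, hs'⟩ := h
      obtain ⟨T, hT, hT'⟩ := ih (S.erase s).card
        (hn ▸ Finset.card_erase_lt_of_mem hs) (S.erase s) rfl
      refine ⟨T, hT.trans ?_, hT'⟩
      apply le_antisymm
      · exact Submodule.span_mono (by simp)
      · refine Submodule.span_le.2 fun x hx => ?_
        by_cases hxs : x = s
        · exact hxs ▸ hs'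
        · exact Submodule.subset_span (Finset.mem_coe.2 (Finset.mem_erase.2 ⟨hxs, hx⟩))
    · push Not at h
      exact ⟨S, rfl, h⟩

lemma exists_functional_s2 {d : ℕ} (T : Finset (Fin d → ℝ))
    (hsc : StronglyConvex (PointedCone.hull ℝ (T : Set (Fin d → ℝ)) : Set (Fin d → ℝ)))
    (hmin : ∀ s ∈ T, s ∉ PointedCone.hull ℝ ((T.erase s : Finset _) : Set (Fin d → ℝ)))
    (s : Fin d → ℝ) (hs : s ∈ T) :
    ∃ u : (Fin d → ℝ) →ₗ[ℝ] ℝ, u s = 0 ∧ ∀ t ∈ T.erase s, 0 < u t := by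
  have hsub : PointedCone.hull ℝ ((T.erase s : Finset _) : Set (Fin d → ℝ)) ≤
      PointedCone.hull ℝ (T : Set (Fin d → ℝ)) := Submodule.span_mono (by simp)
  have hch : convexHull ℝ ((T.erase s : Finset _) : Set (Fin d → ℝ)) ⊆
      PointedCone.hull ℝ ((T.erase s : Finset _) : Set (Fin d → ℝ)) :=
    convexHull_min Submodule.subset_span (PointedCone.convex _)
  have hdisj : Disjoint (convexHull ℝ ((T.erase s : Finset _) : Set (Fin d → ℝ)))
      ((ℝ ∙ s : Submodule ℝ (Fin d → ℝ)) : Set (Fin d → ℝ)) := by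
    rw [Set.disjoint_left]
    intro y hy hys
    obtain ⟨a, rfl⟩ := Submodule.mem_span_singleton.1 hys
    rcases lt_or_ge 0 a with ha | ha
    · apply hmin s hs
      have := hull_smul_mem _ (inv_nonneg.2 ha.le) (hch hy)
      rwa [inv_smul_smul₀ ha.ne'] at this
    · have h0 : a • s = 0 := by
        apply hsc _ (hsub (hch hy))
        rw [← neg_smul]
        exact hull_smul_mem _ (by linarith) (Submodule.subset_span hs)
      rw [h0] at hy
      obtain ⟨w, hw, hw1, hw0⟩ := Finset.mem_convexHull'.1 hy
      obtain ⟨t, ht, htw⟩ : ∃ t ∈ T.erase s, 0 < w t := by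
        by_contra! hcon
        have : ∑ y ∈ T.erase s, w y ≤ 0 := Finset.sum_nonpos hcon
        linarith
      have htT : t ∈ T := Finset.mem_of_mem_erase ht
      have h1 : w t • t = 0 := by
        apply hsc
        · exact hull_smul_mem _ htw.le (Submodule.subset_span htT)
        · have : -(w t • t) = ∑ y ∈ (T.erase s).erase t, w y • y := by
            rw [← Finset.add_sum_erase _ _ ht] at hw0
            exact neg_eq_of_add_eq_zero_right hw0
          rw [this]
          refine Submodule.sum_mem _ fun v hv => ?_
          have hv' := Finset.mem_of_mem_erase hv
          exact hull_smul_mem _ (hw v hv') (Submodule.subset_span (Finset.mem_of_mem_erase hv'))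
      have h2 : t = 0 := (smul_eq_zero.1 h1).resolve_left htw.ne'
      exact hmin t htT (h2 ▸ Submodule.zero_mem _)
  obtain ⟨f, a, b, hfa, hab, hfb⟩ := geometric_hahn_banach_compact_closed (convex_convexHull ℝ _)
    (Set.Finite.isCompact_convexHull ℝ (Finset.finite_toSet (T.erase s)))
    (Submodule.convex _) (Submodule.closed_of_finiteDimensional (ℝ ∙ s)) hdisj
  have hb : b < 0 := by simpa using hfb 0 (Submodule.zero_mem _)
  have hfs : f s = 0 := by
    by_contra hne
    have := hfb ((b / f s) • s) (Submodule.smul_mem _ _ (Submodule.mem_span_singleton_self s))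
    rw [map_smul, smul_eq_mul, div_mul_cancel₀ _ hne] at this
    exact lt_irrefl _ this
  refine ⟨-(f : (Fin d → ℝ) →ₗ[ℝ] ℝ), by simp [hfs], fun t ht => ?_⟩
  have := hfa t (subset_convexHull ℝ _ ht)
  simp only [LinearMap.neg_apply, ContinuousLinearMap.coe_coe]
  linarith

lemma span_le_rays {d : ℕ} (σ : Set (Fin d → ℝ)) (hp : IsPolyhedralCone σ)
    (hsc : StronglyConvex σ) :
    Submodule.span ℝ σ ≤ Submodule.span ℝ (⋃₀ raysOf σ) := by
  obtain ⟨S, rfl⟩ := hp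
  obtain ⟨T, hT, hmin⟩ := exists_min_gen S
  rw [coneHull_eq_hull, ← hT] at hsc ⊢
  have key : ∀ s ∈ T, s ∈ Submodule.span ℝ
      (⋃₀ raysOf (PointedCone.hull ℝ (T : Set (Fin d → ℝ)) : Set (Fin d → ℝ))) := by
    intro s hs
    obtain ⟨u, hus, hut⟩ := exists_functional_s2 T hsc hmin s hs
    have hs0 : s ≠ 0 := by
      rintro rfl
      exact hmin _ hs (Submodule.zero_mem _)
    have hu : ∀ t ∈ T, 0 ≤ u t := by
      intro t ht
      by_cases h : t = s
      · rw [h, hus]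
      · exact (hut t (Finset.mem_erase.2 ⟨h, ht⟩)).le
    refine Submodule.subset_span ⟨{x ∈ (PointedCone.hull ℝ (T : Set (Fin d → ℝ)) :
      Set (Fin d → ℝ)) | u x = 0}, ⟨⟨u, ?_, rfl⟩, ?_⟩, Submodule.subset_span hs, hus⟩
    · intro x hx
      rw [← coneHull_eq_hull] at hx
      obtain ⟨T', c, hT', hc, rfl⟩ := hx
      rw [map_sum]
      refine Finset.sum_nonneg fun v hv => ?_
      rw [map_smul]
      exact mul_nonneg (hc v hv) (hu v (hT' hv))
    · have : Submodule.span ℝ {x ∈ (PointedCone.hull ℝ (T : Set (Fin d → ℝ)) :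
          Set (Fin d → ℝ)) | u x = 0} = ℝ ∙ s := by
        apply le_antisymm
        · refine Submodule.span_le.2 ?_
          rintro x ⟨hx, hx0⟩
          rw [← coneHull_eq_hull] at hx
          obtain ⟨T', c, hT', hc, rfl⟩ := hx
          rw [map_sum, Finset.sum_eq_zero_iff_of_nonneg] at hx0
          · refine Submodule.sum_mem _ fun v hv => ?_
            by_cases h : v = s
            · rw [h]
              exact Submodule.smul_mem _ _ (Submodule.mem_span_singleton_self s)
            · have h1 := hx0 v hv
              rw [map_smul, smul_eq_mul] at h1
              have h2 := hut v (Finset.mem_erase.2 ⟨h, hT' hv⟩)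
              rw [(mul_eq_zero.1 h1).resolve_right h2.ne', zero_smul]
              exact Submodule.zero_mem _
          · intro v hv
            rw [map_smul]
            exact mul_nonneg (hc v hv) (hu v (hT' hv))
        · refine Submodule.span_mono ?_
          rintro x rfl
          exact ⟨Submodule.subset_span hs, hus⟩
      rw [dimSet, this, finrank_span_singleton hs0]
  refine Submodule.span_le.2 fun x hx => ?_
  rw [← coneHull_eq_hull] at hx
  obtain ⟨T', c, hT', hc, rfl⟩ := hx
  exact Submodule.sum_mem _ fun v hv => Submodule.smul_mem _ _ (key v (hT' hv))

lemma raysOf_eq {d : ℕ} {F : Set (Set (Fin d → ℝ))} (hF : IsFan F) {σ : Set (Fin d → ℝ)}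
    (hσ : σ ∈ F) : raysOf σ = {ρ | ρ ∈ F ∧ ρ ⊆ σ ∧ dimSet ρ = 1} := by
  obtain ⟨-, -, h3, h4⟩ := hF
  ext ρ
  constructor
  · rintro ⟨hf, hd⟩
    refine ⟨h3 _ hσ _ hf, ?_, hd⟩
    obtain ⟨u, -, rfl⟩ := hf
    exact Set.sep_subset _ _
  · rintro ⟨hf, hs, hd⟩
    refine ⟨?_, hd⟩
    have := (h4 σ hσ ρ hf).1
    rwa [Set.inter_eq_right.2 hs] at this

lemma finrank_span_sUnion_le {d : ℕ} (R : Finset (Set (Fin d → ℝ)))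
    (hR : ∀ ρ ∈ R, dimSet ρ = 1) (W : Submodule ℝ (Fin d → ℝ)) :
    Module.finrank ℝ ↥(W ⊔ Submodule.span ℝ (⋃₀ (R : Set (Set (Fin d → ℝ))))) ≤
      Module.finrank ℝ W + R.card := by
  classical
  induction R using Finset.induction_on with
  | empty =>
    rw [Finset.coe_empty, Set.sUnion_empty, Submodule.span_empty, sup_bot_eq]
    simp
  | insert ρ R hρ ih =>
    have h1 := ih fun x hx => hR x (Finset.mem_insert_of_mem hx)
    have h2 : Module.finrank ℝ (Submodule.span ℝ ρ) = 1 := hR ρ (Finset.mem_insert_self _ _)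
    rw [Finset.coe_insert, Set.sUnion_insert, Submodule.span_union, sup_comm (Submodule.span ℝ ρ),
      ← sup_assoc, Finset.card_insert_of_notMem hρ]
    have h3 := Submodule.finrank_add_le_finrank_add_finrank
      (W ⊔ Submodule.span ℝ (⋃₀ (R : Set (Set (Fin d → ℝ))))) (Submodule.span ℝ ρ)
    omega

theorem stmt2 {d : ℕ} (F : Set (Set (Fin d → ℝ))) (hF : IsFan F)
    (hns : 0 < nsFan F) (σ σ' : Set (Fin d → ℝ))
    (h : IsMinNonSimpCone F σ) (h' : IsMinNonSimpCone F σ') (hne : σ ≠ σ') :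
    ¬ ∃ μ ∈ F, σ ⊆ μ ∧ σ' ⊆ μ := by
  rintro ⟨μ, hμ, hσμ, hσ'μ⟩
  obtain ⟨hσ, hσN, hσm⟩ := h
  obtain ⟨hσ', hσ'N, hσ'm⟩ := h'
  have hle : ∀ τ ∈ F, nsCone τ ≤ nsFan F := fun τ hτ =>
    le_csSup (hF.1.image _).bddAbove ⟨τ, hτ, rfl⟩
  have hτ : σ ∩ σ' ∈ F := hF.2.2.1 σ hσ _ (hF.2.2.2 σ hσ σ' hσ').1
  have hτN : nsCone (σ ∩ σ') < nsFan F := by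
    refine lt_of_le_of_ne (hle _ hτ) fun he => hne ?_
    rw [← hσm _ hτ he Set.inter_subset_left]
    exact hσ'm _ hτ he Set.inter_subset_right
  have hμN := hle μ hμ
  have hfin : ∀ τ ∈ F, (raysOf τ).Finite := fun τ hτ => by
    rw [raysOf_eq hF hτ]
    exact hF.1.subset fun ρ hρ => hρ.1
  have hRτ : raysOf (σ ∩ σ') = raysOf σ ∩ raysOf σ' := by
    rw [raysOf_eq hF hτ, raysOf_eq hF hσ, raysOf_eq hF hσ']
    ext ρ
    simp only [Set.subset_inter_iff, Set.mem_setOf_eq, Set.mem_inter_iff]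
    tauto
  have hRsub : raysOf σ ∪ raysOf σ' ⊆ raysOf μ := by
    rw [raysOf_eq hF hμ, raysOf_eq hF hσ, raysOf_eq hF hσ']
    rintro ρ (hρ | hρ)
    · exact ⟨hρ.1, hρ.2.1.trans hσμ, hρ.2.2⟩
    · exact ⟨hρ.1, hρ.2.1.trans hσ'μ, hρ.2.2⟩
  have hc1 := Set.ncard_union_add_ncard_inter (raysOf σ) (raysOf σ') (hfin _ hσ) (hfin _ hσ')
  rw [← hRτ] at hc1
  have hc2 := Set.ncard_sdiff_add_ncard_of_subset hRsub (hfin _ hμ)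
  have hE : (raysOf μ \ (raysOf σ ∪ raysOf σ')).Finite := (hfin _ hμ).subset Set.diff_subset
  have hd1 := finrank_span_sUnion_le hE.toFinset
    (fun ρ hρ => ((hE.mem_toFinset.1 hρ).1).2) (Submodule.span ℝ σ ⊔ Submodule.span ℝ σ')
  rw [hE.coe_toFinset, ← Set.ncard_eq_toFinset_card _ hE] at hd1
  have hd2 := Submodule.finrank_sup_add_finrank_inf_eq (Submodule.span ℝ σ) (Submodule.span ℝ σ')
  have hd3 : dimSet (σ ∩ σ') ≤
      Module.finrank ℝ ↥(Submodule.span ℝ σ ⊓ Submodule.span ℝ σ') :=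
    Submodule.finrank_mono (le_inf (Submodule.span_mono Set.inter_subset_left)
      (Submodule.span_mono Set.inter_subset_right))
  have hd4 : dimSet μ ≤ Module.finrank ℝ ↥((Submodule.span ℝ σ ⊔ Submodule.span ℝ σ') ⊔
      Submodule.span ℝ (⋃₀ (raysOf μ \ (raysOf σ ∪ raysOf σ')))) := by
    refine Submodule.finrank_mono ((span_le_rays μ (hF.2.1 μ hμ).1 (hF.2.1 μ hμ).2).trans ?_)
    refine Submodule.span_le.2 ?_
    rintro x ⟨ρ, hρ, hx⟩
    by_cases h1 : ρ ∈ raysOf σ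
    · rw [raysOf_eq hF hσ] at h1
      exact Submodule.mem_sup_left (Submodule.mem_sup_left (Submodule.subset_span (h1.2.1 hx)))
    by_cases h2 : ρ ∈ raysOf σ'
    · rw [raysOf_eq hF hσ'] at h2
      exact Submodule.mem_sup_left (Submodule.mem_sup_right (Submodule.subset_span (h2.2.1 hx)))
    · exact Submodule.mem_sup_right (Submodule.subset_span
        ⟨ρ, ⟨hρ, fun hh => hh.elim h1 h2⟩, hx⟩)
  unfold nsCone at *
  unfold dimSet at *
  omega
end
end

section
/- Let Σ be a fan in ℝ^d with ns(Σ) > 0 and let σ_1, …, σ_k be the (pairwise distinct) minimal non-simplicial cones of Σ. For each i choose a nonzero point v_ρ on every ray ρ of σ_i and set v0_i = ∑_{ρ∈σ_i(1)} v_ρ. Let Σ' be the fan obtained from Σ by successively performing, for i = 1, …, k, the star subdivision along σ_i at the point v0_i (this is well defined: since no cone of Σ contains two of the σ_i, each σ_i remains a cone of the intermediate fans). Then Σ' is a fan with the same support as Σ and ns(Σ') < ns(Σ). -/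
open scoped BigOperators

noncomputable section

section StarAux

variable {d : ℕ}

structure IsConeAux (C : Set (Fin d → ℝ)) : Prop where
  zero : (0 : Fin d → ℝ) ∈ C
  add : ∀ x ∈ C, ∀ y ∈ C, x + y ∈ C
  smul : ∀ a : ℝ, 0 ≤ a → ∀ x ∈ C, a • x ∈ C

theorem coneHull_eq_span (S : Set (Fin d → ℝ)) :
    coneHull S = (Submodule.span {c : ℝ // 0 ≤ c} S : Set (Fin d → ℝ)) := by
  ext x
  constructor
  · rintro ⟨T, c, hT, hc, rfl⟩
    refine Submodule.sum_mem _ fun v hv => ?_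
    exact Submodule.smul_mem _ (⟨c v, hc v hv⟩ : {c : ℝ // 0 ≤ c}) (Submodule.subset_span (hT hv))
  · intro hx
    obtain ⟨f, t, ht, -, rfl⟩ := Submodule.mem_span_iff_exists_finset_subset.1 hx
    exact ⟨t, fun v => (f v : ℝ), ht, fun v _ => (f v).2, rfl⟩

theorem isCone_coneHull (S : Set (Fin d → ℝ)) : IsConeAux (coneHull S) := by
  rw [coneHull_eq_span]
  exact ⟨Submodule.zero_mem _, fun x hx y hy => Submodule.add_mem _ hx hy,
    fun a ha x hx => Submodule.smul_mem _ (⟨a, ha⟩ : {c : ℝ // 0 ≤ c}) hx⟩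

theorem subset_coneHull (S : Set (Fin d → ℝ)) : S ⊆ coneHull S := by
  rw [coneHull_eq_span]; exact Submodule.subset_span

theorem IsConeAux.sum {C : Set (Fin d → ℝ)} (hC : IsConeAux C) {ι : Type*} (T : Finset ι)
    (f : ι → Fin d → ℝ) (h : ∀ i ∈ T, f i ∈ C) : ∑ i ∈ T, f i ∈ C := by
  classical
  induction T using Finset.induction_on with
  | empty => simpa using hC.zero
  | insert a s ha ih =>
    rw [Finset.sum_insert ha]
    exact hC.add _ (h a (by simp)) _ (ih fun i hi => h i (by simp [hi]))

theorem coneHull_min {S C : Set (Fin d → ℝ)} (hC : IsConeAux C) (h : S ⊆ C) : coneHull S ⊆ C := by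
  rintro x ⟨T, c, hT, hc, rfl⟩
  exact hC.sum _ _ fun v hv => hC.smul _ (hc v hv) _ (h (hT hv))

theorem coneHull_of_isCone {C : Set (Fin d → ℝ)} (hC : IsConeAux C) : coneHull C = C :=
  (coneHull_min hC subset_rfl).antisymm (subset_coneHull C)

theorem mem_coneHull_insert {S : Set (Fin d → ℝ)} {v x : Fin d → ℝ} :
    x ∈ coneHull (insert v S) ↔ ∃ t ∈ coneHull S, ∃ a : ℝ, 0 ≤ a ∧ x = t + a • v := by
  simp only [coneHull_eq_span, SetLike.mem_coe, Submodule.mem_span_insert]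
  constructor
  · rintro ⟨a, z, hz, rfl⟩
    exact ⟨z, hz, a, a.2, by rw [add_comm]; rfl⟩
  · rintro ⟨t, ht, a, ha, rfl⟩
    exact ⟨⟨a, ha⟩, t, ht, by rw [add_comm]; rfl⟩

theorem hrep (S : Finset (Fin d → ℝ)) : ∃ U : Finset ((Fin d → ℝ) →ₗ[ℝ] ℝ),
    ∀ x, x ∈ coneHull (S : Set (Fin d → ℝ)) ↔ ∀ u ∈ U, 0 ≤ u x := by
  classical
  induction S using Finset.induction_on with
  | empty =>
    refine ⟨Finset.univ.image (fun i : Fin d => LinearMap.proj i) ∪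
      Finset.univ.image (fun i : Fin d => -LinearMap.proj i), fun x => ?_⟩
    have h0 : x ∈ coneHull ((∅ : Finset (Fin d → ℝ)) : Set (Fin d → ℝ)) ↔ x = 0 := by
      rw [coneHull_eq_span]; simp
    rw [h0]
    constructor
    · rintro rfl; simp
    · intro h
      ext i
      have h1 := h (LinearMap.proj i) (by simp)
      have h2 := h (-LinearMap.proj i) (by simp)
      simp at h1 h2 ⊢
      linarith
  | insert v S hv ih =>
    obtain ⟨U, hU⟩ := ih
    refine ⟨U.filter (fun u => 0 ≤ u v) ∪
      ((U ×ˢ U).filter (fun p => 0 < p.1 v ∧ p.2 v < 0)).image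
        (fun p => (p.1 v) • p.2 - (p.2 v) • p.1), fun x => ?_⟩
    rw [Finset.coe_insert, mem_coneHull_insert]
    constructor
    · rintro ⟨t, ht, a, ha, rfl⟩ u hu
      rw [hU] at ht
      rw [Finset.mem_union, Finset.mem_filter, Finset.mem_image] at hu
      rcases hu with ⟨hu, huv⟩ | ⟨⟨p, q⟩, hpq, rfl⟩
      · have := ht u hu
        simp only [map_add, map_smul, smul_eq_mul]
        positivity
      · simp only [Finset.mem_filter, Finset.mem_product] at hpq
        obtain ⟨⟨hp, hq⟩, hpv, hqv⟩ := hpq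
        have h1 := ht p hp
        have h2 := ht q hq
        simp only [map_add, map_smul, smul_eq_mul, LinearMap.sub_apply, LinearMap.smul_apply]
        nlinarith [mul_nonneg hpv.le h2, mul_nonneg (neg_nonneg.2 hqv.le) h1]
    · intro h
      have hA : ∀ u ∈ U, 0 ≤ u v → 0 ≤ u x := fun u hu huv => h u (by simp [hu, huv])
      have hB : ∀ u ∈ U, ∀ w ∈ U, 0 < u v → w v < 0 → 0 ≤ u v * w x - w v * u x := by
        intro u hu w hw h1 h2
        have := h (u v • w - w v • u) (Finset.mem_union_right _ (Finset.mem_image.2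
          ⟨(u, w), by simp [hu, hw, h1, h2], rfl⟩))
        simpa using this
      let L : Finset ℝ := insert 0 ((U.filter (fun u => u v < 0)).image (fun u => u x / u v))
      have hL : L.Nonempty := ⟨0, by simp [L]⟩
      set a := L.max' hL with ha
      have ha0 : 0 ≤ a := L.le_max' 0 (by simp [L])
      have haL : a ∈ L := L.max'_mem hL
      refine ⟨x - a • v, (hU _).2 fun u hu => ?_, a, ha0, by simp⟩
      simp only [map_sub, map_smul, smul_eq_mul]
      rcases lt_trichotomy (u v) 0 with hneg | h0 | hpos
      · have : u x / u v ≤ a := L.le_max' _ (Finset.mem_insert_of_mem (Finset.mem_image.2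
          ⟨u, by simp [hu, hneg], rfl⟩))
        rw [div_le_iff_of_neg hneg] at this
        linarith
      · have := hA u hu h0.ge
        rw [h0]; simpa using this
      · rcases Finset.mem_insert.1 haL with h0 | h1
        · rw [h0]; have := hA u hu hpos.le; simpa using this
        · obtain ⟨w, hw, hwa⟩ := Finset.mem_image.1 h1
          obtain ⟨hw, hwv⟩ := Finset.mem_filter.1 hw
          have hb := hB u hu w hw hpos hwv
          have : a * w v = w x := by rw [← hwa]; field_simp [hwv.ne]
          rw [← this] at hb
          have h3 : 0 ≤ (-(w v)) * (u x - a * u v) := by linarith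
          exact nonneg_of_mul_nonneg_right h3 (by linarith)

theorem farkas (S : Finset (Fin d → ℝ)) (x : Fin d → ℝ)
    (hx : x ∉ coneHull (S : Set (Fin d → ℝ))) :
    ∃ u : (Fin d → ℝ) →ₗ[ℝ] ℝ, (∀ y ∈ coneHull (S : Set (Fin d → ℝ)), 0 ≤ u y) ∧ u x < 0 := by
  obtain ⟨U, hU⟩ := hrep S
  rw [hU] at hx
  push Not at hx
  obtain ⟨u, hu, hux⟩ := hx
  exact ⟨u, fun y hy => (hU y).1 hy u hu, hux⟩

/-- From a point of the cone walk in direction `-v` until we hit a face. -/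
theorem exists_face_hit {μ : Set (Fin d → ℝ)} (hμ : IsPolyhedralCone μ) {x v : Fin d → ℝ}
    (hx : x ∈ μ) (hv : v ∈ μ) (hnv : -v ∉ μ) :
    ∃ u : (Fin d → ℝ) →ₗ[ℝ] ℝ, (∀ y ∈ μ, 0 ≤ u y) ∧ 0 < u v ∧
      ∃ a : ℝ, 0 ≤ a ∧ x - a • v ∈ μ ∧ u (x - a • v) = 0 := by
  classical
  obtain ⟨S, rfl⟩ := hμ
  obtain ⟨U, hU⟩ := hrep S
  have hne : (U.filter (fun u => 0 < u v)).Nonempty := by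
    rw [hU] at hnv
    push Not at hnv
    obtain ⟨u, hu, huv⟩ := hnv
    exact ⟨u, by simp [hu]; simpa using huv⟩
  obtain ⟨u, hu, hmin⟩ := Finset.exists_min_image _ (fun u : (Fin d → ℝ) →ₗ[ℝ] ℝ => u x / u v) hne
  obtain ⟨hu, huv⟩ := Finset.mem_filter.1 hu
  have hxU := (hU x).1 hx
  have hvU := (hU v).1 hv
  refine ⟨u, fun y hy => (hU y).1 hy u hu, huv, u x / u v, div_nonneg (hxU u hu) huv.le, ?_, ?_⟩
  · rw [hU]
    intro w hw
    simp only [map_sub, map_smul, smul_eq_mul]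
    rcases (hvU w hw).eq_or_lt with h0 | hpos
    · rw [← h0]; simpa using hxU w hw
    · have := hmin w (by simp [hw, hpos])
      rw [le_div_iff₀ hpos] at this
      linarith
  · simp only [map_sub, map_smul, smul_eq_mul]
    field_simp; simp

theorem IsConeAux.of_face {μ τ : Set (Fin d → ℝ)} (hμ : IsConeAux μ) (h : IsFaceOf μ τ) :
    IsConeAux τ := by
  obtain ⟨u, hu, rfl⟩ := h
  refine ⟨⟨hμ.zero, by simp⟩, ?_, ?_⟩
  · rintro x ⟨hx, hx'⟩ y ⟨hy, hy'⟩
    exact ⟨hμ.add _ hx _ hy, by simp [hx', hy']⟩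
  · rintro a ha x ⟨hx, hx'⟩
    exact ⟨hμ.smul _ ha _ hx, by simp [hx']⟩

theorem isFaceOf_subset {μ τ : Set (Fin d → ℝ)} (h : IsFaceOf μ τ) : τ ⊆ μ := by
  obtain ⟨u, hu, rfl⟩ := h
  exact fun x hx => hx.1

theorem IsPolyhedralCone.isCone {μ : Set (Fin d → ℝ)} (h : IsPolyhedralCone μ) : IsConeAux μ := by
  obtain ⟨S, rfl⟩ := h; exact isCone_coneHull _

/-- The span of the rays is the span of the cone. -/
theorem span_rays {μ : Set (Fin d → ℝ)} (hμ : IsPolyhedralCone μ) (hs : StronglyConvex μ) :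
    Submodule.span ℝ (⋃₀ raysOf μ) = Submodule.span ℝ μ := by
  classical
  apply le_antisymm
  · apply Submodule.span_mono
    rintro x ⟨ρ, hρ, hx⟩
    exact isFaceOf_subset hρ.1 hx
  -- choose a minimal generating set
  have hex : ∃ n : ℕ, ∃ S : Finset (Fin d → ℝ), S.card = n ∧ μ = coneHull ↑S := by
    obtain ⟨S, hS⟩ := hμ; exact ⟨_, S, rfl, hS⟩
  obtain ⟨S, hcard, hS⟩ := Nat.find_spec hex
  have hminS : ∀ v ∈ S, v ∉ coneHull ((S.erase v : Finset _) : Set (Fin d → ℝ)) := by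
    intro v hv hmem
    refine Nat.find_min hex (m := (S.erase v).card) ?_ ⟨S.erase v, rfl, ?_⟩
    · rw [← hcard]; exact Finset.card_erase_lt_of_mem hv
    · rw [hS]
      apply Set.Subset.antisymm
      · apply coneHull_min (isCone_coneHull _)
        intro w hw
        by_cases hwv : w = v
        · rw [hwv]; exact hmem
        · exact subset_coneHull _ (by simp [hwv]; exact hw)
      · apply coneHull_min (isCone_coneHull _)
        intro w hw
        exact subset_coneHull _ (by simp at hw; exact hw.1)
  have hS0 : ∀ v ∈ S, v ≠ 0 := by
    rintro v hv rfl
    exact hminS 0 hv (isCone_coneHull _).zero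
  have hSμ : ∀ v ∈ S, v ∈ μ := fun v hv => by rw [hS]; exact subset_coneHull _ hv
  have hcμ : IsConeAux μ := by rw [hS]; exact isCone_coneHull _
  have hsub : (S : Set (Fin d → ℝ)) ⊆ ⋃₀ raysOf μ := by
    intro v hv
    have hv' : v ∈ S := hv
    have hSE : (S : Set (Fin d → ℝ)) = insert v ((S.erase v : Finset _) : Set (Fin d → ℝ)) := by
      rw [← Finset.coe_insert, Finset.insert_erase hv']
    have key : ∀ s ∈ S.erase v, ∃ u : (Fin d → ℝ) →ₗ[ℝ] ℝ,
        (∀ y ∈ μ, 0 ≤ u y) ∧ u v = 0 ∧ 0 < u s := by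
      intro s hsS
      have hsS' := Finset.mem_of_mem_erase hsS
      have hnot : -s ∉ coneHull ((insert (-v) S : Finset _) : Set (Fin d → ℝ)) := by
        rw [Finset.coe_insert, mem_coneHull_insert]
        rintro ⟨t, ht, b, hb, hst⟩
        rw [hSE, mem_coneHull_insert] at ht
        obtain ⟨t, ht, c, hc, rfl⟩ := ht
        have hCE := isCone_coneHull ((S.erase v : Finset _) : Set (Fin d → ℝ))
        have hsE : s ∈ coneHull ((S.erase v : Finset _) : Set (Fin d → ℝ)) :=
          subset_coneHull _ hsS
        rcases lt_or_ge c b with hcb | hcb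
        · apply hminS v hv'
          have : v = (b - c)⁻¹ • (s + t) := by
            have h1 : s + t = (b - c) • v := by
              have : s = -(t + c • v + b • -v) := by rw [← hst]; simp
              rw [this]; module
            rw [h1, smul_smul, inv_mul_cancel₀ (by linarith), one_smul]
          have hm := hCE.smul (b - c)⁻¹ (inv_nonneg.2 (by linarith)) _ (hCE.add _ hsE _ ht)
          rwa [← this] at hm
        · apply hS0 s hsS'
          apply hs s (hSμ s hsS')
          have : -s = t + (c - b) • v := by rw [hst]; module
          rw [this, hS, hSE, mem_coneHull_insert]
          exact ⟨t, ht, c - b, by linarith, rfl⟩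
      obtain ⟨u, hu, hus⟩ := farkas _ _ hnot
      have huS : ∀ y ∈ μ, 0 ≤ u y := by
        intro y hy
        apply hu
        rw [Finset.coe_insert, mem_coneHull_insert]
        exact ⟨y, by rw [← hS]; exact hy, 0, le_rfl, by simp⟩
      refine ⟨u, huS, le_antisymm ?_ (huS v (hSμ v hv')), by simpa using hus⟩
      have := hu (-v) (subset_coneHull _ (by simp))
      simpa using this
    choose! U hU1 hU2 hU3 using key
    set u := ∑ s ∈ S.erase v, U s with hu
    have hunn : ∀ y ∈ μ, 0 ≤ u y := by
      intro y hy
      rw [hu, LinearMap.sum_apply]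
      exact Finset.sum_nonneg fun s hs => hU1 s hs y hy
    have huv : u v = 0 := by
      rw [hu, LinearMap.sum_apply]
      exact Finset.sum_eq_zero fun s hs => hU2 s hs
    have hupos : ∀ s ∈ S.erase v, 0 < u s := by
      intro s hsS
      rw [hu, LinearMap.sum_apply]
      exact Finset.sum_pos' (fun w hw => hU1 w hw s (hSμ s (Finset.mem_of_mem_erase hsS)))
        ⟨s, hsS, hU3 s hsS⟩
    refine ⟨{x ∈ μ | u x = 0}, ⟨⟨u, hunn, rfl⟩, ?_⟩, hSμ v hv', huv⟩
    have hspan : Submodule.span ℝ {x ∈ μ | u x = 0} = Submodule.span ℝ {v} := by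
      apply le_antisymm
      · rw [Submodule.span_le]
        rintro x ⟨hx, hux⟩
        rw [hS, hSE, mem_coneHull_insert] at hx
        obtain ⟨t, ⟨T, c, hT, hc, rfl⟩, a, ha, rfl⟩ := hx
        have h0 : ∑ w ∈ T, c w * u w = 0 := by
          simpa [huv] using hux
        have h1 := (Finset.sum_eq_zero_iff_of_nonneg
          (fun w hw => mul_nonneg (hc w hw) (hupos w (hT hw)).le)).1 h0
        have h2 : ∑ w ∈ T, c w • w = 0 := by
          apply Finset.sum_eq_zero
          intro w hw
          have := h1 w hw
          rcases mul_eq_zero.1 this with h | h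
          · rw [h, zero_smul]
          · exact absurd h (hupos w (hT hw)).ne'
        rw [h2, zero_add]
        exact Submodule.smul_mem _ _ (Submodule.mem_span_singleton_self v)
      · apply Submodule.span_mono
        rintro x rfl
        exact ⟨hSμ x hv', huv⟩
    rw [dimSet, hspan]
    exact finrank_span_singleton (hS0 v hv')
  rw [Submodule.span_le]
  intro x hx
  rw [hS] at hx
  obtain ⟨T, c, hT, hc, rfl⟩ := hx
  exact Submodule.sum_mem _ fun w hw => Submodule.smul_mem _ _
    (Submodule.subset_span (hsub (hT hw)))

def joinV (τ : Set (Fin d → ℝ)) (v : Fin d → ℝ) : Set (Fin d → ℝ) :=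
  {x | ∃ t ∈ τ, ∃ a : ℝ, 0 ≤ a ∧ x = t + a • v}

theorem coneHull_union_eq {τ : Set (Fin d → ℝ)} (hτ : IsConeAux τ) (v : Fin d → ℝ) :
    coneHull (τ ∪ {v}) = joinV τ v := by
  ext x
  rw [Set.union_singleton, mem_coneHull_insert, coneHull_of_isCone hτ]
  rfl

theorem subset_joinV (τ : Set (Fin d → ℝ)) (v : Fin d → ℝ) : τ ⊆ joinV τ v :=
  fun x hx => ⟨x, hx, 0, le_rfl, by simp⟩

theorem mem_joinV {τ : Set (Fin d → ℝ)} (h0 : (0 : Fin d → ℝ) ∈ τ) (v : Fin d → ℝ) : v ∈ joinV τ v :=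
  ⟨0, h0, 1, zero_le_one, by simp⟩

theorem joinV_subset {τ μ : Set (Fin d → ℝ)} {v : Fin d → ℝ} (hμ : IsConeAux μ) (h : τ ⊆ μ)
    (hv : v ∈ μ) : joinV τ v ⊆ μ := by
  rintro x ⟨t, ht, a, ha, rfl⟩
  exact hμ.add _ (h ht) _ (hμ.smul _ ha _ hv)

theorem joinV_polyhedral {τ : Set (Fin d → ℝ)} (hτ : IsPolyhedralCone τ) (v : Fin d → ℝ) :
    IsPolyhedralCone (joinV τ v) := by
  classical
  obtain ⟨S, rfl⟩ := hτ
  refine ⟨insert v S, ?_⟩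
  ext x
  rw [Finset.coe_insert, mem_coneHull_insert]
  rfl

/-- Faces of `joinV τ v`. -/
theorem face_joinV {τ φ : Set (Fin d → ℝ)} {v : Fin d → ℝ} (hτ : IsConeAux τ)
    (h : IsFaceOf (joinV τ v) φ) :
    IsFaceOf τ φ ∨ ∃ τ', IsFaceOf τ τ' ∧ φ = joinV τ' v := by
  obtain ⟨u, hu, rfl⟩ := h
  have hut : ∀ x ∈ τ, 0 ≤ u x := fun x hx => hu x (subset_joinV τ v hx)
  have huv : 0 ≤ u v := hu v (mem_joinV hτ.zero v)
  rcases huv.eq_or_lt with h0 | hpos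
  · right
    refine ⟨{x ∈ τ | u x = 0}, ⟨u, hut, rfl⟩, ?_⟩
    ext x
    constructor
    · rintro ⟨⟨t, ht, a, ha, rfl⟩, hx⟩
      refine ⟨t, ⟨ht, ?_⟩, a, ha, rfl⟩
      simpa [← h0] using hx
    · rintro ⟨t, ⟨ht, ht0⟩, a, ha, rfl⟩
      exact ⟨⟨t, ht, a, ha, rfl⟩, by simp [ht0, ← h0]⟩
  · left
    refine ⟨u, hut, ?_⟩
    ext x
    constructor
    · rintro ⟨⟨t, ht, a, ha, rfl⟩, hx⟩
      have h1 := hut t ht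
      simp only [map_add, map_smul, smul_eq_mul] at hx
      have h2 : a * u v = 0 := le_antisymm (by linarith) (by positivity)
      have h3 : a = 0 := (mul_eq_zero.1 h2).resolve_right hpos.ne'
      subst h3
      simp at hx ⊢
      exact ⟨ht, hx⟩
    · rintro ⟨hx, hx0⟩
      exact ⟨subset_joinV τ v hx, hx0⟩

def RelIntPt (σ : Set (Fin d → ℝ)) (v : Fin d → ℝ) : Prop :=
  v ∈ σ ∧ ∀ u : (Fin d → ℝ) →ₗ[ℝ] ℝ, (∀ x ∈ σ, 0 ≤ u x) → u v = 0 → ∀ x ∈ σ, u x = 0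

theorem fan_isCone {F : Set (Set (Fin d → ℝ))} (hF : IsFan F) {τ : Set (Fin d → ℝ)} (h : τ ∈ F) :
    IsConeAux τ := (hF.2.1 τ h).1.isCone

theorem fan_face {F : Set (Set (Fin d → ℝ))} (hF : IsFan F) {τ μ : Set (Fin d → ℝ)}
    (hτ : τ ∈ F) (hμ : μ ∈ F) (h : τ ⊆ μ) : IsFaceOf μ τ := by
  have := (hF.2.2.2 μ hμ τ hτ).1
  rwa [Set.inter_eq_right.2 h] at this

theorem fan_inter {F : Set (Set (Fin d → ℝ))} (hF : IsFan F) {τ μ : Set (Fin d → ℝ)}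
    (hτ : τ ∈ F) (hμ : μ ∈ F) : τ ∩ μ ∈ F :=
  hF.2.2.1 τ hτ _ (hF.2.2.2 τ hτ μ hμ).1

theorem relint_sub {F : Set (Set (Fin d → ℝ))} (hF : IsFan F) {σ τ : Set (Fin d → ℝ)}
    {v : Fin d → ℝ} (hσ : σ ∈ F) (hv : RelIntPt σ v) (hτ : τ ∈ F) (h : v ∈ τ) : σ ⊆ τ := by
  obtain ⟨u, hu, he⟩ := (hF.2.2.2 σ hσ τ hτ).1
  have h1 : v ∈ σ ∩ τ := ⟨hv.1, h⟩
  have h1' : v ∈ {x ∈ σ | u x = 0} := he ▸ h1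
  have h2 := hv.2 u hu h1'.2
  intro x hx
  have : x ∈ σ ∩ τ := by rw [he]; exact ⟨hx, h2 x hx⟩
  exact this.2

/-- `τ` belongs to the closed star of `σ` but does not contain `σ`. -/
def StarLink (F : Set (Set (Fin d → ℝ))) (σ τ : Set (Fin d → ℝ)) : Prop :=
  τ ∈ F ∧ ¬ σ ⊆ τ ∧ ∃ μ ∈ F, σ ⊆ μ ∧ τ ⊆ μ

theorem mem_star {F : Set (Set (Fin d → ℝ))} (hF : IsFan F) {σ : Set (Fin d → ℝ)}
    {v : Fin d → ℝ} {c : Set (Fin d → ℝ)} :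
    c ∈ starSubdiv F σ v ↔ (c ∈ F ∧ ¬ σ ⊆ c) ∨ ∃ τ, StarLink F σ τ ∧ c = joinV τ v := by
  constructor
  · rintro (h | ⟨μ, hμ, hσμ, τ, hτ, hστ, rfl⟩)
    · exact Or.inl h
    · have hτF := hF.2.2.1 μ hμ τ hτ
      exact Or.inr ⟨τ, ⟨hτF, hστ, μ, hμ, hσμ, isFaceOf_subset hτ⟩,
        coneHull_union_eq (fan_isCone hF hτF) v⟩
  · rintro (h | ⟨τ, ⟨hτ, hστ, μ, hμ, hσμ, hτμ⟩, rfl⟩)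
    · exact Or.inl h
    · exact Or.inr ⟨μ, hμ, hσμ, τ, fan_face hF hτ hμ hτμ, hστ,
        (coneHull_union_eq (fan_isCone hF hτ) v).symm⟩

theorem link_sep {F : Set (Set (Fin d → ℝ))} (hF : IsFan F) {σ τ : Set (Fin d → ℝ)}
    {v : Fin d → ℝ} (hσ : σ ∈ F) (hv : RelIntPt σ v) (hτ : StarLink F σ τ) :
    ∃ u : (Fin d → ℝ) →ₗ[ℝ] ℝ, (∀ x ∈ τ, u x = 0) ∧ 0 < u v := by
  obtain ⟨hτF, hστ, μ, hμ, hσμ, hτμ⟩ := hτ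
  obtain ⟨u, hu, he⟩ := fan_face hF hτF hμ hτμ
  have hvμ := hσμ hv.1
  refine ⟨u, fun x hx => ?_, lt_of_le_of_ne (hu v hvμ) fun h0 => ?_⟩
  · rw [he] at hx; exact hx.2
  · exact hστ (relint_sub hF hσ hv hτF (by rw [he]; exact ⟨hvμ, h0.symm⟩))

theorem link_face {F : Set (Set (Fin d → ℝ))} (hF : IsFan F) {σ τ τ' : Set (Fin d → ℝ)}
    (hτ : StarLink F σ τ) (h : τ' ⊆ τ) (h' : τ' ∈ F) : StarLink F σ τ' := by
  obtain ⟨hτF, hστ, μ, hμ, hσμ, hτμ⟩ := hτ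
  exact ⟨h', fun h2 => hστ (h2.trans h), μ, hμ, hσμ, h.trans hτμ⟩

/-- old-new intersection, sharp form -/
theorem old_new {F : Set (Set (Fin d → ℝ))} (hF : IsFan F) {σ τ μ : Set (Fin d → ℝ)}
    {v : Fin d → ℝ} (hσ : σ ∈ F) (hv : RelIntPt σ v) (hτ : StarLink F σ τ) (hμ : μ ∈ F)
    (hσμ : ¬ σ ⊆ μ) {t : Fin d → ℝ} (ht : t ∈ τ) {a : ℝ} (ha : 0 ≤ a) (hx : t + a • v ∈ μ) :
    a = 0 := by
  by_contra hne
  obtain ⟨hτF, hστ, ν, hν, hσν, hτν⟩ := hτ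
  have hcν := fan_isCone hF hν
  obtain ⟨u, hu, he⟩ := (hF.2.2.2 ν hν μ hμ).1
  have hvν := hσν hv.1
  have h1 : t + a • v ∈ ν ∩ μ := ⟨hcν.add _ (hτν ht) _ (hcν.smul _ ha _ hvν), hx⟩
  rw [he] at h1
  have h2 := h1.2
  simp only [map_add, map_smul, smul_eq_mul] at h2
  have h3 := hu t (hτν ht)
  have h4 := hu v hvν
  have h5 : a * u v = 0 := le_antisymm (by linarith) (by positivity)
  have h6 : u v = 0 := (mul_eq_zero.1 h5).resolve_left hne
  have h7 : v ∈ ν ∩ μ := by rw [he]; exact ⟨hvν, h6⟩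
  exact hσμ (relint_sub hF hσ hv hμ h7.2)

theorem star_isFan {F : Set (Set (Fin d → ℝ))} (hF : IsFan F) {σ : Set (Fin d → ℝ)}
    {v : Fin d → ℝ} (hσ : σ ∈ F) (hv : RelIntPt σ v) : IsFan (starSubdiv F σ v) := by
  -- intersections of an old cone and a new cone
  have hON : ∀ μ ∈ F, ¬ σ ⊆ μ → ∀ τ, StarLink F σ τ →
      IsFaceOf μ (μ ∩ joinV τ v) ∧ IsFaceOf (joinV τ v) (μ ∩ joinV τ v) := by
    intro μ hμ hσμ τ hτ
    have he : μ ∩ joinV τ v = μ ∩ τ := by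
      apply Set.Subset.antisymm
      · rintro x ⟨hx, t, ht, a, ha, rfl⟩
        have := old_new hF hσ hv hτ hμ hσμ ht ha hx
        subst this
        simp only [zero_smul, add_zero] at hx ⊢
        exact ⟨hx, ht⟩
      · exact Set.inter_subset_inter_right _ (subset_joinV τ v)
    rw [he]
    refine ⟨(hF.2.2.2 μ hμ τ hτ.1).1, ?_⟩
    obtain ⟨u1, hu1, he1⟩ := (hF.2.2.2 μ hμ τ hτ.1).2
    obtain ⟨u2, hu2, hu2v⟩ := link_sep hF hσ hv hτ
    have hw : ∀ t ∈ τ, ∀ a : ℝ, (u1 + ((1 - u1 v) / u2 v) • u2) (t + a • v) = u1 t + a := by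
      intro t ht a
      simp only [LinearMap.add_apply, LinearMap.smul_apply, map_add, map_smul, smul_eq_mul,
        hu2 t ht]
      field_simp
      ring
    refine ⟨u1 + ((1 - u1 v) / u2 v) • u2, ?_, ?_⟩
    · rintro x ⟨t, ht, a, ha, rfl⟩
      rw [hw t ht]
      have := hu1 t ht
      linarith
    · rw [he1]
      ext x
      constructor
      · rintro ⟨hx, hx0⟩
        refine ⟨subset_joinV _ _ hx, ?_⟩
        have := hw x hx 0
        simp only [zero_smul, add_zero] at this
        rw [this, hx0]
      · rintro ⟨⟨t, ht, a, ha, rfl⟩, hx⟩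
        rw [hw t ht] at hx
        have := hu1 t ht
        have ha0 : a = 0 := by linarith
        subst ha0
        simp only [zero_smul, add_zero] at hx ⊢
        exact ⟨ht, hx⟩
  have hNN1 : ∀ τ, StarLink F σ τ → ∀ τ', StarLink F σ τ' → ∀ t ∈ τ, ∀ a : ℝ, 0 ≤ a →
      ∀ t' ∈ τ', ∀ a' : ℝ, 0 ≤ a' → t + a • v = t' + a' • v → a' ≤ a → t = t' ∧ a = a' := by
    intro τ hτ τ' hτ' t ht a ha t' ht' a' ha' h haa
    have h1 : t + (a - a') • v = t' := by
      have : t = t' + a' • v - a • v := by rw [← h]; simp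
      rw [this]; module
    have := old_new hF hσ hv hτ hτ'.1 hτ'.2.1 ht (a := a - a') (by linarith) (by rw [h1]; exact ht')
    refine ⟨?_, by linarith⟩
    rw [this] at h1; simpa using h1
  have hNNe : ∀ τ, StarLink F σ τ → ∀ τ', StarLink F σ τ' →
      joinV τ v ∩ joinV τ' v = joinV (τ ∩ τ') v := by
    intro τ hτ τ' hτ'
    apply Set.Subset.antisymm
    · rintro x ⟨⟨t, ht, a, ha, rfl⟩, t', ht', a', ha', h⟩
      have : t = t' ∧ a = a' := by
        rcases le_total a' a with hle | hle
        · exact hNN1 τ hτ τ' hτ' t ht a ha t' ht' a' ha' h hle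
        · have := hNN1 τ' hτ' τ hτ t' ht' a' ha' t ht a ha h.symm hle
          exact ⟨this.1.symm, this.2.symm⟩
      obtain ⟨rfl, rfl⟩ := this
      exact ⟨t, ⟨ht, ht'⟩, a, ha, rfl⟩
    · rintro x ⟨t, ⟨ht, ht'⟩, a, ha, rfl⟩
      exact ⟨⟨t, ht, a, ha, rfl⟩, t, ht', a, ha, rfl⟩
  have hNN : ∀ τ, StarLink F σ τ → ∀ τ', StarLink F σ τ' →
      IsFaceOf (joinV τ v) (joinV τ v ∩ joinV τ' v) := by
    intro τ hτ τ' hτ'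
    rw [hNNe τ hτ τ' hτ']
    obtain ⟨u1, hu1, he1⟩ := (hF.2.2.2 τ hτ.1 τ' hτ'.1).1
    obtain ⟨u2, hu2, hu2v⟩ := link_sep hF hσ hv hτ
    have hw : ∀ t ∈ τ, ∀ a : ℝ, (u1 - (u1 v / u2 v) • u2) (t + a • v) = u1 t := by
      intro t ht a
      simp only [LinearMap.sub_apply, LinearMap.smul_apply, map_add, map_smul, smul_eq_mul,
        hu2 t ht]
      field_simp
      ring
    refine ⟨u1 - (u1 v / u2 v) • u2, ?_, ?_⟩
    · rintro x ⟨t, ht, a, ha, rfl⟩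
      rw [hw t ht]
      exact hu1 t ht
    · rw [he1]
      ext x
      constructor
      · rintro ⟨t, ⟨ht, ht0⟩, a, ha, rfl⟩
        exact ⟨⟨t, ht, a, ha, rfl⟩, by rw [hw t ht, ht0]⟩
      · rintro ⟨⟨t, ht, a, ha, rfl⟩, hx⟩
        rw [hw t ht] at hx
        exact ⟨t, ⟨ht, hx⟩, a, ha, rfl⟩
  refine ⟨?_, ?_, ?_, ?_⟩
  · refine (hF.1.union (hF.1.image (fun τ => joinV τ v))).subset ?_
    intro c hc
    rcases (mem_star hF).1 hc with h | ⟨τ, hτ, rfl⟩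
    · exact Or.inl h.1
    · exact Or.inr ⟨τ, hτ.1, rfl⟩
  · intro c hc
    rcases (mem_star hF).1 hc with h | ⟨τ, hτ, rfl⟩
    · exact hF.2.1 c h.1
    · refine ⟨joinV_polyhedral (hF.2.1 τ hτ.1).1 v, ?_⟩
      obtain ⟨-, -, μ, hμ, hσμ, hτμ⟩ := hτ
      have hsub := joinV_subset (fan_isCone hF hμ) hτμ (hσμ hv.1)
      exact fun x hx hx' => (hF.2.1 μ hμ).2 x (hsub hx) (hsub hx')
  · intro c hc φ hφ
    rw [mem_star hF]
    rcases (mem_star hF).1 hc with h | ⟨τ, hτ, rfl⟩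
    · exact Or.inl ⟨hF.2.2.1 c h.1 φ hφ, fun h2 => h.2 (h2.trans (isFaceOf_subset hφ))⟩
    · rcases face_joinV (fan_isCone hF hτ.1) hφ with h | ⟨τ', hτ', rfl⟩
      · exact Or.inl ⟨hF.2.2.1 τ hτ.1 φ h, fun h2 => hτ.2.1 (h2.trans (isFaceOf_subset h))⟩
      · exact Or.inr ⟨τ', link_face hF hτ (isFaceOf_subset hτ') (hF.2.2.1 τ hτ.1 τ' hτ'), rfl⟩
  · intro c hc c' hc'
    rcases (mem_star hF).1 hc with h | ⟨τ, hτ, rfl⟩ <;>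
      rcases (mem_star hF).1 hc' with h' | ⟨τ', hτ', rfl⟩
    · exact hF.2.2.2 c h.1 c' h'.1
    · exact hON c h.1 h.2 τ' hτ'
    · have := hON c' h'.1 h'.2 τ hτ
      rw [Set.inter_comm]
      exact this.symm
    · refine ⟨hNN τ hτ τ' hτ', ?_⟩
      rw [Set.inter_comm]
      exact hNN τ' hτ' τ hτ

theorem star_support {F : Set (Set (Fin d → ℝ))} (hF : IsFan F) {σ : Set (Fin d → ℝ)}
    {v : Fin d → ℝ} (hσ : σ ∈ F) (hv : RelIntPt σ v) (hv0 : v ≠ 0) :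
    ⋃₀ starSubdiv F σ v = ⋃₀ F := by
  ext x
  constructor
  · rintro ⟨c, hc, hx⟩
    rcases (mem_star hF).1 hc with h | ⟨τ, ⟨-, -, μ, hμ, hσμ, hτμ⟩, rfl⟩
    · exact ⟨c, h.1, hx⟩
    · exact ⟨μ, hμ, joinV_subset (fan_isCone hF hμ) hτμ (hσμ hv.1) hx⟩
  · rintro ⟨μ, hμ, hx⟩
    by_cases hσμ : σ ⊆ μ
    · have hvμ := hσμ hv.1
      obtain ⟨u, hu, huv, a, ha, hy, hy0⟩ := exists_face_hit (hF.2.1 μ hμ).1 hx hvμ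
        (fun h => hv0 ((hF.2.1 μ hμ).2 v hvμ h))
      have hface : IsFaceOf μ {y ∈ μ | u y = 0} := ⟨u, hu, rfl⟩
      refine ⟨joinV {y ∈ μ | u y = 0} v, (mem_star hF).2 (Or.inr ⟨_, ⟨hF.2.2.1 μ hμ _ hface, ?_,
        μ, hμ, hσμ, fun y hy => hy.1⟩, rfl⟩), x - a • v, ⟨hy, hy0⟩, a, ha, by simp⟩
      intro h
      exact huv.ne' (h hv.1).2
    · exact ⟨μ, (mem_star hF).2 (Or.inl ⟨hμ, hσμ⟩), hx⟩

theorem finrank_span_sUnion_le_s4 (A C : Set (Set (Fin d → ℝ))) (hC : C.Finite)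
    (h1 : ∀ ρ ∈ C, dimSet ρ = 1) :
    Module.finrank ℝ (Submodule.span ℝ (⋃₀ (A ∪ C))) ≤
      Module.finrank ℝ (Submodule.span ℝ (⋃₀ A)) + C.ncard := by
  induction C, hC using Set.Finite.induction_on with
  | empty => rw [Set.union_empty]; simp
  | @insert ρ C hρ hC ih =>
    have ih' := ih fun ρ' hρ' => h1 ρ' (Set.mem_insert_of_mem _ hρ')
    have hr := h1 ρ (Set.mem_insert _ _)
    rw [Set.ncard_insert_of_notMem hρ hC, Set.union_insert, Set.sUnion_insert,
      Submodule.span_union]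
    have := Submodule.finrank_add_le_finrank_add_finrank (Submodule.span ℝ ρ)
      (Submodule.span ℝ (⋃₀ (A ∪ C)))
    rw [dimSet] at hr
    omega

theorem nullity_mono {A B : Set (Set (Fin d → ℝ))} (hB : B.Finite) (hAB : A ⊆ B)
    (h1 : ∀ ρ ∈ B, dimSet ρ = 1) :
    (A.ncard : ℤ) - Module.finrank ℝ (Submodule.span ℝ (⋃₀ A)) ≤
      (B.ncard : ℤ) - Module.finrank ℝ (Submodule.span ℝ (⋃₀ B)) := by
  have h2 := finrank_span_sUnion_le_s4 A (B \ A) (hB.subset Set.sdiff_subset) (fun ρ hρ => h1 ρ hρ.1)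
  rw [Set.union_sdiff_cancel hAB] at h2
  have h3 := Set.ncard_sdiff_add_ncard_of_subset hAB hB
  omega

theorem nullity_inter {A B : Set (Set (Fin d → ℝ))} (hA : A.Finite) (hB : B.Finite) :
    (A.ncard : ℤ) - Module.finrank ℝ (Submodule.span ℝ (⋃₀ A)) +
      ((B.ncard : ℤ) - Module.finrank ℝ (Submodule.span ℝ (⋃₀ B))) ≤
    ((A ∪ B).ncard : ℤ) - Module.finrank ℝ (Submodule.span ℝ (⋃₀ (A ∪ B))) +
      (((A ∩ B).ncard : ℤ) - Module.finrank ℝ (Submodule.span ℝ (⋃₀ (A ∩ B)))) := by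
  have h1 := Set.ncard_union_add_ncard_inter A B hA hB
  have h2 := Submodule.finrank_sup_add_finrank_inf_eq (Submodule.span ℝ (⋃₀ A))
    (Submodule.span ℝ (⋃₀ B))
  rw [← Submodule.span_union, ← Set.sUnion_union] at h2
  have h3 : Submodule.span ℝ (⋃₀ (A ∩ B)) ≤
      Submodule.span ℝ (⋃₀ A) ⊓ Submodule.span ℝ (⋃₀ B) :=
    le_inf (Submodule.span_mono (Set.sUnion_subset_sUnion Set.inter_subset_left))
      (Submodule.span_mono (Set.sUnion_subset_sUnion Set.inter_subset_right))
  have h4 := Submodule.finrank_mono h3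
  omega

theorem ns_eq {F : Set (Set (Fin d → ℝ))} (hF : IsFan F) {μ : Set (Fin d → ℝ)} (hμ : μ ∈ F) :
    nsCone μ = ((raysOf μ).ncard : ℤ) -
      Module.finrank ℝ (Submodule.span ℝ (⋃₀ raysOf μ)) := by
  rw [nsCone, dimSet, span_rays (hF.2.1 μ hμ).1 (hF.2.1 μ hμ).2]

theorem rays_finite {F : Set (Set (Fin d → ℝ))} (hF : IsFan F) {μ : Set (Fin d → ℝ)}
    (hμ : μ ∈ F) : (raysOf μ).Finite :=
  hF.1.subset fun ρ hρ => hF.2.2.1 μ hμ ρ hρ.1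

theorem rays_sub {F : Set (Set (Fin d → ℝ))} (hF : IsFan F) {τ μ : Set (Fin d → ℝ)}
    (hτ : τ ∈ F) (hμ : μ ∈ F) (h : τ ⊆ μ) : raysOf τ ⊆ raysOf μ := fun ρ hρ =>
  ⟨fan_face hF (hF.2.2.1 τ hτ ρ hρ.1) hμ ((isFaceOf_subset hρ.1).trans h), hρ.2⟩

theorem rays_inter {F : Set (Set (Fin d → ℝ))} (hF : IsFan F) {τ μ : Set (Fin d → ℝ)}
    (hτ : τ ∈ F) (hμ : μ ∈ F) : raysOf (τ ∩ μ) = raysOf τ ∩ raysOf μ := by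
  have hi := fan_inter hF hτ hμ
  apply Set.Subset.antisymm
  · exact Set.subset_inter (rays_sub hF hi hτ Set.inter_subset_left)
      (rays_sub hF hi hμ Set.inter_subset_right)
  · rintro ρ ⟨h1, h2⟩
    exact ⟨fan_face hF (hF.2.2.1 τ hτ ρ h1.1) hi
      (Set.subset_inter (isFaceOf_subset h1.1) (isFaceOf_subset h2.1)), h1.2⟩

theorem ns_inter {F : Set (Set (Fin d → ℝ))} (hF : IsFan F) {σ τ μ : Set (Fin d → ℝ)}
    (hσ : σ ∈ F) (hτ : τ ∈ F) (hμ : μ ∈ F) (h1 : σ ⊆ μ) (h2 : τ ⊆ μ) :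
    nsCone σ + nsCone τ ≤ nsCone μ + nsCone (σ ∩ τ) := by
  rw [ns_eq hF hσ, ns_eq hF hτ, ns_eq hF hμ, ns_eq hF (fan_inter hF hσ hτ), rays_inter hF hσ hτ]
  have h3 := nullity_inter (rays_finite hF hσ) (rays_finite hF hτ)
  have h4 := nullity_mono (rays_finite hF hμ)
    (Set.union_subset (rays_sub hF hσ hμ h1) (rays_sub hF hτ hμ h2)) (fun ρ hρ => hρ.2)
  linarith

theorem dim_joinV {τ : Set (Fin d → ℝ)} {v : Fin d → ℝ} (h0 : (0 : Fin d → ℝ) ∈ τ)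
    (u : (Fin d → ℝ) →ₗ[ℝ] ℝ) (hu : ∀ x ∈ τ, u x = 0) (huv : 0 < u v) :
    dimSet (joinV τ v) = dimSet τ + 1 := by
  have hv0 : v ≠ 0 := by rintro rfl; simp at huv
  have hs : Submodule.span ℝ (joinV τ v) = Submodule.span ℝ τ ⊔ Submodule.span ℝ {v} := by
    rw [← Submodule.span_union]
    apply le_antisymm
    · rw [Submodule.span_le]
      rintro x ⟨t, ht, a, ha, rfl⟩
      exact Submodule.add_mem _ (Submodule.subset_span (Or.inl ht))
        (Submodule.smul_mem _ _ (Submodule.subset_span (Or.inr rfl)))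
    · apply Submodule.span_mono
      rintro x (hx | rfl)
      · exact subset_joinV _ _ hx
      · exact mem_joinV h0 _
  have hi : Submodule.span ℝ τ ⊓ Submodule.span ℝ {v} = ⊥ := by
    rw [eq_bot_iff]
    rintro x ⟨hx1, hx2⟩
    obtain ⟨a, rfl⟩ := Submodule.mem_span_singleton.1 hx2
    have hk : Submodule.span ℝ τ ≤ LinearMap.ker u := Submodule.span_le.2 hu
    have := hk hx1
    simp only [LinearMap.mem_ker, map_smul, smul_eq_mul] at this
    rw [(mul_eq_zero.1 this).resolve_right huv.ne']
    simp
  have h2 := Submodule.finrank_sup_add_finrank_inf_eq (Submodule.span ℝ τ)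
    (Submodule.span ℝ {v})
  rw [hi, ← hs, finrank_span_singleton hv0, finrank_bot] at h2
  simpa [dimSet] using h2

theorem ns_joinV {F : Set (Set (Fin d → ℝ))} (hF : IsFan F) {σ τ : Set (Fin d → ℝ)}
    {v : Fin d → ℝ} (hσ : σ ∈ F) (hv : RelIntPt σ v) (hτ : StarLink F σ τ) :
    nsCone (joinV τ v) ≤ nsCone τ := by
  obtain ⟨u, hu, huv⟩ := link_sep hF hσ hv hτ
  have hc := fan_isCone hF hτ.1
  have hsub : raysOf (joinV τ v) ⊆ insert (joinV {0} v) (raysOf τ) := by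
    rintro ρ ⟨hρ, hρ1⟩
    rcases face_joinV hc hρ with h | ⟨τ', hτ', rfl⟩
    · exact Or.inr ⟨h, hρ1⟩
    · left
      have h0 := (hc.of_face hτ').zero
      rw [dim_joinV h0 u (fun x hx => hu x (isFaceOf_subset hτ' hx)) huv] at hρ1
      have h1 : Module.finrank ℝ (Submodule.span ℝ τ') = 0 := by simpa [dimSet] using hρ1
      rw [Submodule.finrank_eq_zero, Submodule.span_eq_bot] at h1
      have : τ' = {0} := Set.Subset.antisymm h1 (by rintro x rfl; exact h0)
      rw [this]
  have hfin := rays_finite hF hτ.1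
  have h1 := Set.ncard_le_ncard hsub (hfin.insert _)
  have h2 := Set.ncard_insert_le (joinV {0} v) (raysOf τ)
  rw [nsCone, nsCone, dim_joinV hc.zero u hu huv]
  push_cast
  omega

theorem relInt_sum {F : Set (Set (Fin d → ℝ))} (hF : IsFan F) {σ : Set (Fin d → ℝ)}
    (hσ : σ ∈ F) (w : Set (Fin d → ℝ) → (Fin d → ℝ))
    (hw : ∀ ρ ∈ raysOf σ, w ρ ∈ ρ ∧ w ρ ≠ 0) :
    RelIntPt σ (∑ᶠ ρ ∈ raysOf σ, w ρ) := by
  have hfin := rays_finite hF hσ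
  rw [finsum_mem_eq_finite_toFinset_sum _ hfin]
  have hmem : ∀ ρ ∈ hfin.toFinset, w ρ ∈ σ := by
    intro ρ hρ
    rw [Set.Finite.mem_toFinset] at hρ
    exact isFaceOf_subset hρ.1 (hw ρ hρ).1
  refine ⟨(fan_isCone hF hσ).sum _ _ hmem, fun u hu h0 => ?_⟩
  rw [map_sum] at h0
  have h1 := (Finset.sum_eq_zero_iff_of_nonneg (fun ρ hρ => hu _ (hmem ρ hρ))).1 h0
  have h2 : Submodule.span ℝ (⋃₀ raysOf σ) ≤ LinearMap.ker u := by
    rw [Submodule.span_le]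
    rintro x ⟨ρ, hρ, hx⟩
    have h3 : u (w ρ) = 0 := h1 ρ ((Set.Finite.mem_toFinset _).2 hρ)
    have h4 : Module.finrank ℝ (Submodule.span ℝ ρ) = 1 := hρ.2
    have h5 := (finrank_eq_one_iff_of_nonzero'
      (⟨w ρ, Submodule.subset_span (hw ρ hρ).1⟩ : Submodule.span ℝ ρ)
      (by simpa [Subtype.ext_iff] using (hw ρ hρ).2)).1 h4 ⟨x, Submodule.subset_span hx⟩
    obtain ⟨c, hc⟩ := h5
    have h6 : c • w ρ = x := congrArg Subtype.val hc
    simp [← h6, h3]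
  rw [span_rays (hF.2.1 σ hσ).1 (hF.2.1 σ hσ).2] at h2
  exact fun x hx => h2 (Submodule.subset_span hx)

theorem relInt_ne_zero {F : Set (Set (Fin d → ℝ))} (hF : IsFan F) {σ : Set (Fin d → ℝ)}
    {v : Fin d → ℝ} (hσ : σ ∈ F) (hv : RelIntPt σ v) (x : Fin d → ℝ) (hx : x ∈ σ) (hx0 : x ≠ 0) :
    v ≠ 0 := by
  rintro rfl
  have hn : -x ∉ σ := fun h => hx0 ((hF.2.1 σ hσ).2 x hx h)
  obtain ⟨S, hS⟩ := (hF.2.1 σ hσ).1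
  rw [hS] at hn
  obtain ⟨u, hu, hux⟩ := farkas _ _ hn
  rw [← hS] at hu
  have := hv.2 u hu (by simp) x hx
  simp [this] at hux

end StarAux

theorem stmt4 {d : ℕ} (F : Set (Set (Fin d → ℝ))) (hF : IsFan F)
    (hns : 0 < nsFan F) (k : ℕ) (σ : Fin k → Set (Fin d → ℝ))
    (hinj : Function.Injective σ)
    (hmin : ∀ i, IsMinNonSimpCone F (σ i))
    (hall : ∀ τ, IsMinNonSimpCone F τ → ∃ i, τ = σ i)
    (v : Fin k → Set (Fin d → ℝ) → (Fin d → ℝ))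
    (hv : ∀ i, ∀ ρ ∈ raysOf (σ i), v i ρ ∈ ρ ∧ v i ρ ≠ 0)
    (v0 : Fin k → (Fin d → ℝ)) (hv0 : ∀ i, v0 i = ∑ᶠ ρ ∈ raysOf (σ i), v i ρ)
    (G : Fin (k + 1) → Set (Set (Fin d → ℝ)))
    (hG0 : G 0 = F)
    (hGs : ∀ i : Fin k, G i.succ = starSubdiv (G i.castSucc) (σ i) (v0 i)) :
    IsFan (G (Fin.last k)) ∧ ⋃₀ (G (Fin.last k)) = ⋃₀ F ∧
      nsFan (G (Fin.last k)) < nsFan F := by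
  have hle : ∀ c ∈ F, nsCone c ≤ nsFan F := fun c hc =>
    le_csSup (hF.1.image _).bddAbove ⟨c, hc, rfl⟩
  have main : ∀ i : Fin (k + 1), IsFan (G i) ∧ ⋃₀ (G i) = ⋃₀ F ∧
      (∀ c ∈ G i, nsCone c < nsFan F ∨ (c ∈ F ∧ ∀ j : Fin k, j.castSucc < i → ¬ σ j ⊆ c)) ∧
      (∀ j : Fin k, i ≤ j.castSucc → σ j ∈ G i) := by
    intro i
    induction i using Fin.induction with
    | zero =>
      rw [hG0]
      refine ⟨hF, rfl, fun c hc => Or.inr ⟨hc, fun j hj => ?_⟩, fun j _ => (hmin j).1⟩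
      exact absurd hj (Fin.not_lt_zero _)
    | succ i ih =>
      obtain ⟨hfan, hsupp, hcones, hmem⟩ := ih
      have hσ := hmem i le_rfl
      have hrel : RelIntPt (σ i) (v0 i) := by
        rw [hv0]; exact relInt_sum hfan hσ _ (hv i)
      have hvne : v0 i ≠ 0 := by
        have hpos : 0 < nsCone (σ i) := by rw [(hmin i).2.1]; exact hns
        have hnc : (raysOf (σ i)).ncard ≠ 0 := by
          intro h
          rw [nsCone, h] at hpos
          push_cast at hpos
          omega
        obtain ⟨ρ, hρ⟩ := Set.nonempty_of_ncard_ne_zero hnc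
        exact relInt_ne_zero hfan hσ hrel _ (isFaceOf_subset hρ.1 (hv i ρ hρ).1) (hv i ρ hρ).2
      rw [hGs]
      have hleG : ∀ c ∈ G i.castSucc, nsCone c ≤ nsFan F := by
        intro c hc
        rcases hcones c hc with h | h
        · exact h.le
        · exact hle c h.1
      refine ⟨star_isFan hfan hσ hrel, ?_, ?_, ?_⟩
      · rw [star_support hfan hσ hrel hvne, hsupp]
      · intro c hc
        rcases (mem_star hfan).1 hc with ⟨hcG, hcσ⟩ | ⟨τ, hτ, rfl⟩
        · rcases hcones c hcG with h | ⟨hcF, h⟩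
          · exact Or.inl h
          · refine Or.inr ⟨hcF, fun j hj => ?_⟩
            rcases (Fin.le_castSucc_iff.2 hj).lt_or_eq with h1 | h1
            · exact h j h1
            · rw [Fin.castSucc_injective _ h1]; exact hcσ
        · left
          refine lt_of_le_of_lt (ns_joinV hfan hσ hrel hτ) ?_
          by_contra hcon
          push Not at hcon
          obtain ⟨hτG, hστ, μ, hμ, hσμ, hτμ⟩ := hτ
          have h1 := ns_inter hfan hσ hτG hμ hσμ hτμ
          have h2 := hleG μ hμ
          have h3 := (hmin i).2.1
          have h4 : σ i ∩ τ ∈ F := hF.2.2.1 _ (hmin i).1 _ (hfan.2.2.2 _ hσ _ hτG).1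
          have h5 := hle _ h4
          have h6 := (hmin i).2.2 _ h4 (by linarith) Set.inter_subset_left
          exact hστ (Set.inter_eq_left.1 h6)
      · intro j hj
        have hij : i < j := by
          rw [Fin.le_def] at hj
          simp at hj
          rw [Fin.lt_def]; omega
        refine (mem_star hfan).2 (Or.inl ⟨hmem j ?_, fun h => ?_⟩)
        · exact (Fin.castSucc_lt_castSucc_iff.2 hij).le
        · have := (hmin j).2.2 _ (hmin i).1 (hmin i).2.1 h
          exact hij.ne (hinj this)
  obtain ⟨hfan, hsupp, hcones, -⟩ := main (Fin.last k)
  refine ⟨hfan, hsupp, ?_⟩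
  have hlt : ∀ c ∈ G (Fin.last k), nsCone c < nsFan F := by
    intro c hc
    rcases hcones c hc with h | ⟨hcF, h⟩
    · exact h
    · refine lt_of_le_of_ne (hle c hcF) fun heq => ?_
      have hfin : {τ ∈ F | nsCone τ = nsFan F ∧ τ ⊆ c}.Finite := hF.1.subset fun τ hτ => hτ.1
      obtain ⟨m, hm⟩ := hfin.exists_minimal ⟨c, hcF, heq, subset_rfl⟩
      have hmm : IsMinNonSimpCone F m := by
        refine ⟨hm.1.1, hm.1.2.1, fun τ hτ hτn hτm => ?_⟩
        exact Set.Subset.antisymm hτm (hm.2 ⟨hτ, hτn, hτm.trans hm.1.2.2⟩ hτm)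
      obtain ⟨i, rfl⟩ := hall m hmm
      exact h i (Fin.castSucc_lt_last i) hm.1.2.2
  rcases (G (Fin.last k)).eq_empty_or_nonempty with he | hne
  · rw [nsFan, he]
    simpa using hns
  · have := (hne.image nsCone).csSup_mem (hfan.1.image nsCone)
    obtain ⟨c, hc, he⟩ := this
    rw [nsFan, ← he]
    exact hlt c hc
end
end
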